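/- arXiv:1606.06903 — 2 statements merged into one kernel-verified Lean document; each statement's English description precedes it below -/
import Mathlib

section
/- Let 𝐗 and 𝐘 be disjoint nonempty node sets in a DAG D, and assume there exists a set, disjoint from 𝐗 ∪ 𝐘, satisfying the adjustment criterion relative to (𝐗,𝐘) in D. Then there is no generalized back-door set relative to (𝐗,𝐘) in D if and only if there exist X ∈ 𝐗, Y ∈ 𝐘, a path p from X to Y in D and a node V on p such that: (i) p is a proper non-causal path from 𝐗 to 𝐘; (ii) V ∈ Adjust(𝐗,𝐘,D) ∩ De(𝐗,D) and V is a non-collider on p; (iii) every collider on p is in Adjust(𝐗,𝐘,D) \ De(𝐗,D) and every non-collider on the subpath of p from V to Y is in forb(𝐗,𝐘,D); (iv) p traversed from Y to X is a directed path from Y to X and V is the node adjacent to Y on p (i.e., p has the form X ← ⋯ ← V ← Y). -/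
attribute [local instance] Classical.propDecidable

/-- A finite directed acyclic graph on vertex type `V`. -/
structure DAG (V : Type) [Fintype V] [DecidableEq V] where
  /-- the edge relation: `Edge a b` means there is a directed edge `a → b` -/
  Edge : V → V → Prop
  /-- there are no directed cycles -/
  acyclic : ∀ v, ¬ Relation.TransGen Edge v v

namespace DAG

variable {V : Type} [Fintype V] [DecidableEq V]

/-- two nodes are adjacent if they are joined by an edge in either direction -/
def Adj (D : DAG V) (a b : V) : Prop := D.Edge a b ∨ D.Edge b a

/-- `p` is a path from `x` to `y`: a list of distinct nodes, consecutive ones adjacent,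
starting at `x` and ending at `y`. -/
def IsPathFrom (D : DAG V) (p : List V) (x y : V) : Prop :=
  p.Nodup ∧ p.Chain' D.Adj ∧ p.head? = some x ∧ p.getLast? = some y

/-- a causal (directed) path: all edges point forward -/
def IsCausal (D : DAG V) (p : List V) : Prop := p.Chain' D.Edge

/-- descendants of a set of nodes (every node is its own descendant) -/
def Desc (D : DAG V) (S : Set V) : Set V :=
  {v | ∃ w ∈ S, Relation.ReflTransGen D.Edge w v}

/-- ancestors of a set of nodes (every node is its own ancestor) -/
def Anc (D : DAG V) (S : Set V) : Set V :=
  {v | ∃ w ∈ S, Relation.ReflTransGen D.Edge v w}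

/-- `w` is a collider on the path `p`: both edges of `p` at `w` point into `w` -/
def IsColliderOn (D : DAG V) (p : List V) (w : V) : Prop :=
  ∃ a b, [a, w, b] <:+: p ∧ D.Edge a w ∧ D.Edge b w

/-- `w` is a non-collider on `p`: a non-endpoint node of `p` that is not a collider on `p` -/
def IsNonColliderOn (D : DAG V) (p : List V) (w : V) : Prop :=
  (∃ a b, [a, w, b] <:+: p) ∧ ¬ D.IsColliderOn p w

/-- `Z` blocks the path `p`: some non-collider on `p` is in `Z`, or some collider on `p`
has no descendant in `Z`.  Otherwise `p` is d-connecting given `Z`. -/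
def Blocks (D : DAG V) (Z : Set V) (p : List V) : Prop :=
  (∃ w, D.IsNonColliderOn p w ∧ w ∈ Z) ∨
  (∃ w, D.IsColliderOn p w ∧ D.Desc {w} ∩ Z = ∅)

/-- `p` is a proper causal path from `X` to `Y` -/
def ProperCausalPath (D : DAG V) (X Y : Set V) (p : List V) : Prop :=
  (∃ x ∈ X, ∃ y ∈ Y, D.IsPathFrom p x y) ∧ (∀ v ∈ p.tail, v ∉ X) ∧ D.IsCausal p

/-- `p` is a proper non-causal path from `X` to `Y` -/
def ProperNonCausalPath (D : DAG V) (X Y : Set V) (p : List V) : Prop :=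
  (∃ x ∈ X, ∃ y ∈ Y, D.IsPathFrom p x y) ∧ (∀ v ∈ p.tail, v ∉ X) ∧ ¬ D.IsCausal p

/-- the forbidden set: all descendants of nodes `W ∉ X` lying on a proper causal path
from `X` to `Y` -/
def Forb (D : DAG V) (X Y : Set V) : Set V :=
  {v | ∃ p w, D.ProperCausalPath X Y p ∧ w ∈ p ∧ w ∉ X ∧
    Relation.ReflTransGen D.Edge w v}

/-- the adjustment criterion of Shpitser et al. / van der Zander et al. -/
def SatisfiesAC (D : DAG V) (X Y Z : Set V) : Prop :=
  Z ∩ D.Forb X Y = ∅ ∧ ∀ p, D.ProperNonCausalPath X Y p → D.Blocks Z p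

/-- the constructive set `Adjust(X,Y,D)` -/
def AdjustSet (D : DAG V) (X Y : Set V) : Set V :=
  D.Anc (X ∪ Y) \ (X ∪ Y ∪ D.Forb X Y)

/-- `Z` d-separates `X` and `Y` in `D`: `Z` blocks every path from `X` to `Y` -/
def DSep (D : DAG V) (X Y Z : Set V) : Prop :=
  ∀ x ∈ X, ∀ y ∈ Y, ∀ p, D.IsPathFrom p x y → D.Blocks Z p

/-- `p` is a back-door path from `x`: its first edge points into `x` -/
def IsBackdoorFrom (D : DAG V) (p : List V) (x : V) : Prop :=
  ∃ b rest, p = x :: b :: rest ∧ D.Edge b x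

/-- Pearl's back-door criterion -/
def BackdoorCriterion (D : DAG V) (X Y Z : Set V) : Prop :=
  Z ∩ D.Desc X = ∅ ∧
  ∀ x ∈ X, ∀ y ∈ Y, ∀ p, D.IsPathFrom p x y → D.IsBackdoorFrom p x → D.Blocks Z p

/-- the generalized back-door criterion of Maathuis and Colombo -/
def GenBackdoorCriterion (D : DAG V) (X Y Z : Set V) : Prop :=
  Z ∩ D.Desc X = ∅ ∧
  ∀ x ∈ X, ∀ y ∈ Y, ∀ p, D.IsPathFrom p x y → D.IsBackdoorFrom p x →
    D.Blocks ((Z ∪ X) \ {x}) p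

end DAG


namespace DAG

variable {V : Type} [Fintype V] [DecidableEq V]

/-- condition (C2): a proper non-causal path from `X` to `Y` with all colliders in
`Adjust(X,Y,D)` and all non-colliders in `forb(X,Y,D)` -/
def CondC2 (D : DAG V) (X Y : Set V) : Prop :=
  ∃ p, D.ProperNonCausalPath X Y p ∧
    (∀ w, D.IsColliderOn p w → w ∈ D.AdjustSet X Y) ∧
    (∀ w, D.IsNonColliderOn p w → w ∈ D.Forb X Y)

/-- condition (C3): a proper non-causal path `p` of the form `x ← ⋯ ← v ← y` with
`v ∈ Adjust(X,Y,D) ∩ De(X,D)` a non-collider on `p`, every collider on `p` in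
`Adjust(X,Y,D) \ De(X,D)`, and every non-collider on the subpath of `p` from `v` to `y`
in `forb(X,Y,D)` -/
def CondC3 (D : DAG V) (X Y : Set V) : Prop :=
  ∃ x ∈ X, ∃ y ∈ Y, ∃ p v, D.IsPathFrom p x y ∧
    D.ProperNonCausalPath X Y p ∧
    v ∈ D.AdjustSet X Y ∩ D.Desc X ∧ D.IsNonColliderOn p v ∧
    (∀ w, D.IsColliderOn p w → w ∈ D.AdjustSet X Y \ D.Desc X) ∧
    (∀ s, s <:+ p → s.head? = some v →
      ∀ w, D.IsNonColliderOn s w → w ∈ D.Forb X Y) ∧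
    D.IsCausal p.reverse ∧ [v, y] <:+ p

/-- condition (C4): a back-door path `p` from `x ∈ X` to `y ∈ Y` with no colliders,
all nodes in `De(X,D)`, and a proper subpath that is a proper causal path from `X` to
`Y` starting at some `x'' ∈ X` with `x'' ≠ x` -/
def CondC4 (D : DAG V) (X Y : Set V) : Prop :=
  ∃ x ∈ X, ∃ y ∈ Y, ∃ p, D.IsPathFrom p x y ∧
    D.IsBackdoorFrom p x ∧
    (∃ x'' ∈ X, x'' ≠ x ∧ ∃ s, s <:+ p ∧ s.head? = some x'' ∧
      D.ProperCausalPath X Y s) ∧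
    (∀ w, ¬ D.IsColliderOn p w) ∧
    (∀ w ∈ p, w ∈ D.Desc X)


section Auxiliary

open Relation

variable {D : DAG V} {X Y Z : Set V}

theorem Edge.asymm {a b : V} (h : D.Edge a b) : ¬ D.Edge b a := fun h' =>
  D.acyclic a (.tail (.single h) h')

theorem isChain_of_isInfix {α : Type*} {R : α → α → Prop} {l l' : List α} (h : l.IsChain R)
    (hi : l' <:+: l) : l'.IsChain R := by
  obtain ⟨s, t, rfl⟩ := hi
  exact (List.isChain_append.1 (List.isChain_append.1 h).1).2.1

theorem pairwise_transGen {l : List V} (h : l.IsChain D.Edge) :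
    l.Pairwise (TransGen D.Edge) :=
  (h.imp fun _ _ => TransGen.single).pairwise

theorem nodup_of_isChain {l : List V} (h : l.IsChain D.Edge) : l.Nodup :=
  (pairwise_transGen h).imp fun hab e => by
    subst e
    exact D.acyclic _ hab

theorem neighbors_unique_of_nodup {α : Type*} {p : List α} (hp : p.Nodup) {a w b a' b' : α}
    (h : [a, w, b] <:+: p) (h' : [a', w, b'] <:+: p) : a = a' ∧ b = b' := by
  obtain ⟨s, t, rfl⟩ := h
  obtain ⟨s', t', h'⟩ := h'
  have e : (s' ++ [a']) ++ w :: (b' :: t') = (s ++ [a]) ++ w :: (b :: t) := by simpa using h'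
  have hp' : ((s ++ [a]) ++ w :: (b :: t)).Nodup := by simpa using hp
  have hp'' := e ▸ hp'
  have h1 : w ∉ s' ++ [a'] := fun hm =>
    (List.nodup_append.1 hp'').2.2 w hm w (by simp) rfl
  have h2 : w ∉ s ++ [a] := fun hm =>
    (List.nodup_append.1 hp').2.2 w hm w (by simp) rfl
  have h3 : w ∉ b' :: t' := (List.nodup_cons.1 (List.nodup_append.1 hp'').2.1).1
  have h4 : w ∉ b :: t := (List.nodup_cons.1 (List.nodup_append.1 hp').2.1).1
  have key := (List.append_cons_inj_of_notMem (by tauto) (by tauto)).1 e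
  obtain ⟨k1, k2⟩ := key
  have := (List.append_inj' k1 rfl).2
  simp at this k2
  exact ⟨this.symm, k2.1.symm⟩

/-- No node of the list `l` is a collider on `l`. -/
def ColliderFree (D : DAG V) (l : List V) : Prop := ∀ w, ¬ D.IsColliderOn l w

theorem colliderFree_of_isChain {l : List V} (h : l.IsChain D.Edge) : D.ColliderFree l := by
  rintro w ⟨a, b, hi, -, hb⟩
  have := isChain_of_isInfix h hi
  simp at this
  exact hb.asymm this.2

theorem colliderFree_of_isChain_reverse {l : List V} (h : l.reverse.IsChain D.Edge) :
    D.ColliderFree l := by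
  rintro w ⟨a, b, hi, ha, -⟩
  have := isChain_of_isInfix (List.isChain_reverse.1 h) hi
  simp at this
  exact ha.asymm this.1

theorem ColliderFree.of_isInfix {l l' : List V} (h : D.ColliderFree l) (hi : l' <:+: l) :
    D.ColliderFree l' := fun w ⟨a, b, hi', hab⟩ => h w ⟨a, b, hi'.trans hi, hab⟩

theorem ColliderFree.cons {u u' : V} {l : List V} (h : D.ColliderFree (u :: l))
    (he : D.Edge u u') : D.ColliderFree (u' :: u :: l) := by
  rintro w ⟨a, b, hi, ha, hb⟩
  rcases List.infix_cons_iff.1 hi with hi | hi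
  · obtain ⟨t, ht⟩ := hi
    simp at ht
    obtain ⟨rfl, rfl, -⟩ := ht
    exact he.asymm ha
  · exact h w ⟨a, b, hi, ha, hb⟩

/-- `l` is the tail, after its head `u`, of a collider-free path to `Y` that stays inside
`forb(X,Y,D) \ X`. -/
def ForbPath (D : DAG V) (X Y : Set V) (u : V) (l : List V) : Prop :=
  (u :: l).Nodup ∧ (u :: l).IsChain D.Adj ∧ (∃ y ∈ Y, (u :: l).getLast? = some y) ∧
    (∀ z ∈ u :: l, z ∈ D.Forb X Y ∧ z ∉ X) ∧ D.ColliderFree (u :: l)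

theorem exists_forbPath_of_mem {u u' : V} {l : List V} (h : D.ForbPath X Y u l)
    (hu : u' ∈ u :: l) : ∃ l', D.ForbPath X Y u' l' := by
  obtain ⟨h1, h2, ⟨y, hy, h3⟩, h4, h5⟩ := h
  obtain ⟨s, t, e⟩ := List.append_of_mem hu
  have hs : u' :: t <:+ u :: l := ⟨s, e.symm⟩
  refine ⟨t, h1.sublist hs.sublist, isChain_of_isInfix h2 hs.isInfix, ⟨y, hy, ?_⟩,
    fun z hz => h4 z (hs.subset hz), h5.of_isInfix hs.isInfix⟩
  rw [e] at h3
  simpa using h3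

theorem forb_of_reflTransGen {u v : V} (hu : u ∈ D.Forb X Y)
    (h : ReflTransGen D.Edge u v) : v ∈ D.Forb X Y := by
  obtain ⟨p, w, hp, hw, hwX, hwu⟩ := hu
  exact ⟨p, w, hp, hw, hwX, hwu.trans h⟩

theorem not_forbPath_of_edge (hZ : D.SatisfiesAC X Y Z) {u x : V} {l : List V}
    (h : D.ForbPath X Y u l) (hx : x ∈ X) (he : D.Edge u x) : False := by
  obtain ⟨h1, h2, ⟨y, hy, h3⟩, h4, h5⟩ := h
  have hb := hZ.2 (x :: u :: l) ⟨⟨x, hx, y, hy, ?_, ?_, rfl, ?_⟩, fun v hv => (h4 v hv).2, ?_⟩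
  · rcases hb with ⟨w, ⟨⟨a, b, hi⟩, -⟩, hwZ⟩ | ⟨w, hw, -⟩
    · have hw : w ∈ u :: l := by
        rcases List.infix_cons_iff.1 hi with hi | hi
        · obtain ⟨t, ht⟩ := hi
          simp at ht
          simp [ht.2.1]
        · exact hi.subset (by simp)
      exact Set.eq_empty_iff_forall_notMem.1 hZ.1 w ⟨hwZ, (h4 w hw).1⟩
    · exact h5.cons he w hw
  · exact List.nodup_cons.2 ⟨fun hm => (h4 x hm).2 hx, h1⟩
  · exact List.isChain_cons_cons.2 ⟨Or.inr he, h2⟩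
  · simpa using h3
  · intro hc
    exact he.asymm (List.isChain_cons_cons.1 hc).1

theorem disjoint_forb_anc (hZ : D.SatisfiesAC X Y Z) {v : V} (hv : v ∈ D.Forb X Y)
    (hv' : v ∈ D.Anc X) : False := by
  obtain ⟨p, w, ⟨⟨x, hx, y, hy, hp⟩, ht, hc⟩, hw, hwX, hwv⟩ := hv
  obtain ⟨x', hx', hvx⟩ := hv'
  have key : ∀ u, ReflTransGen D.Edge w u → u ∉ X ∧ ∃ l, D.ForbPath X Y u l := by
    intro u hu
    induction hu with
    | refl =>
      refine ⟨hwX, ?_⟩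
      obtain ⟨s, t, e⟩ := List.append_of_mem hw
      have hs : w :: t <:+ p := ⟨s, e.symm⟩
      have hX : ∀ z ∈ w :: t, z ∉ X := by
        intro z hz
        rcases List.mem_cons.1 hz with rfl | hz
        · exact hwX
        · apply ht
          rw [e]
          cases s <;> simp [hz]
      refine ⟨t, hp.1.sublist hs.sublist, isChain_of_isInfix hp.2.1 hs.isInfix, ⟨y, hy, ?_⟩,
        fun z hz => ⟨⟨p, z, ⟨⟨x, hx, y, hy, hp⟩, ht, hc⟩, hs.subset hz, hX z hz, .refl⟩, hX z hz⟩,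
        colliderFree_of_isChain (isChain_of_isInfix hc hs.isInfix)⟩
      have := hp.2.2.2
      rw [e] at this
      simpa using this
    | @tail u u' _ he ih =>
      obtain ⟨-, l, hl⟩ := ih
      have hu' : u' ∉ X := fun hX => not_forbPath_of_edge hZ hl hX he
      refine ⟨hu', ?_⟩
      by_cases hm : u' ∈ u :: l
      · exact exists_forbPath_of_mem hl hm
      · obtain ⟨h1, h2, ⟨y', hy', h3⟩, h4, h5⟩ := hl
        refine ⟨u :: l, List.nodup_cons.2 ⟨hm, h1⟩, List.isChain_cons_cons.2 ⟨Or.inr he, h2⟩,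
          ⟨y', hy', by simpa using h3⟩, ?_, h5.cons he⟩
        intro z hz
        rcases List.mem_cons.1 hz with rfl | hz
        · exact ⟨forb_of_reflTransGen (h4 u (by simp)).1 (.single he), hu'⟩
        · exact h4 z hz
  exact (key x' (hwv.trans hvx)).1 hx'

theorem mem_forb_of_desc {b y : V} (hb : b ∈ D.Desc X) (hbX : b ∉ X) (hy : y ∈ Y)
    (h : ReflTransGen (fun a c => D.Edge a c ∧ c ∉ X) b y) : b ∈ D.Forb X Y := by
  obtain ⟨x, hx, hxb⟩ := hb
  have base : ∃ l, (b :: l).IsChain D.Edge ∧ (b :: l).getLast? = some y ∧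
      ∀ z ∈ b :: l, z ∉ X := by
    clear hxb
    induction h using ReflTransGen.head_induction_on with
    | refl => exact ⟨[], by simp, by simp, by simpa using hbX⟩
    | @head a c hac _ ih =>
      obtain ⟨l, h1, h2, h3⟩ := ih hac.2
      refine ⟨c :: l, List.isChain_cons_cons.2 ⟨hac.1, h1⟩, by simpa using h2, ?_⟩
      intro z hz
      rcases List.mem_cons.1 hz with rfl | hz
      · exact hbX
      · exact h3 z hz
  have key : (∃ l, b ∈ x :: l ∧ (x :: l).IsChain D.Edge ∧ (x :: l).getLast? = some y ∧
      ∀ z ∈ x :: l, z ∉ X) ∨ b ∈ D.Forb X Y := by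
    clear hx
    induction hxb using ReflTransGen.head_induction_on with
    | refl =>
      obtain ⟨l, hl⟩ := base
      exact Or.inl ⟨l, by simp, hl⟩
    | @head a c hac _ ih =>
      rcases ih with ⟨l, h0, h1, h2, h3⟩ | ih
      · have hc : (a :: c :: l).IsChain D.Edge := List.isChain_cons_cons.2 ⟨hac, h1⟩
        have hl : (a :: c :: l).getLast? = some y := by simpa using h2
        by_cases ha : a ∈ X
        · refine Or.inr ⟨a :: c :: l, b, ⟨⟨a, ha, y, hy, nodup_of_isChain hc,
            hc.imp fun _ _ => Or.inl, rfl, hl⟩, h3, hc⟩, List.mem_cons_of_mem _ h0, hbX, .refl⟩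
        · refine Or.inl ⟨c :: l, List.mem_cons_of_mem _ h0, hc, hl, ?_⟩
          intro z hz
          rcases List.mem_cons.1 hz with rfl | hz
          · exact ha
          · exact h3 z hz
      · exact Or.inr ih
  rcases key with ⟨l, -, -, -, h⟩ | h
  · exact absurd hx (h x (by simp))
  · exact h

theorem exists_isChain_to {a x : V} (hx : x ∈ X) (h : ReflTransGen D.Edge a x) (ha : a ∉ X) :
    ∃ l, ∃ x' ∈ X, (a :: (l ++ [x'])).IsChain D.Edge ∧ ∀ z ∈ a :: l, z ∉ X := by
  induction h using ReflTransGen.head_induction_on with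
  | refl => exact absurd hx ha
  | @head a c hac _ ih =>
    by_cases hc : c ∈ X
    · exact ⟨[], c, hc, by simpa using hac, by simpa using ha⟩
    · obtain ⟨l, x', hx', h1, h2⟩ := ih hc
      refine ⟨c :: l, x', hx', List.isChain_cons_cons.2 ⟨hac, h1⟩, ?_⟩
      intro z hz
      rcases List.mem_cons.1 hz with rfl | hz
      · exact ha
      · exact h2 z hz

theorem condC3_of_edge (hXY : Disjoint X Y) {v y : V} (hv : v ∈ D.AdjustSet X Y)
    (hvD : v ∈ D.Desc X) (hvA : v ∈ D.Anc X) (hy : y ∈ Y) (he : D.Edge y v) :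
    D.CondC3 X Y := by
  have hvX : v ∉ X := fun h => hv.2 (Or.inl (Or.inl h))
  have hyX : y ∉ X := fun h => Set.disjoint_left.1 hXY h hy
  obtain ⟨x, hx, hvx⟩ := hvA
  obtain ⟨l, x', hx', hc, hl⟩ := exists_isChain_to hx hvx hvX
  have hc' : (y :: v :: (l ++ [x'])).IsChain D.Edge := List.isChain_cons_cons.2 ⟨he, hc⟩
  obtain ⟨p, hp⟩ : ∃ p, p = x' :: l.reverse ++ [v, y] := ⟨_, rfl⟩
  have hpr : p.reverse = y :: v :: (l ++ [x']) := by simp [hp]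
  have hrev : p.reverse.IsChain D.Edge := hpr ▸ hc'
  have hnd : p.Nodup := List.nodup_reverse.1 (nodup_of_isChain hrev)
  have hcf := colliderFree_of_isChain_reverse hrev
  have hpath : D.IsPathFrom p x' y :=
    ⟨hnd, (List.isChain_reverse.1 hrev).imp fun _ _ => Or.inr, by simp [hp], by
      rw [hp, List.getLast?_append]
      rfl⟩
  have hsuf : [v, y] <:+ p := ⟨x' :: l.reverse, hp.symm⟩
  refine ⟨x', hx', y, hy, p, v, hpath, ⟨⟨x', hx', y, hy, hpath⟩, ?_, ?_⟩, ⟨hv, hvD⟩,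
    ⟨?_, hcf v⟩, fun w hw => absurd hw (hcf w), ?_, hrev, hsuf⟩
  · intro z hz
    simp [hp] at hz
    rcases hz with hz | rfl | rfl
    · exact hl z (by simp [hz])
    · exact hvX
    · exact hyX
  · intro hcau
    have := isChain_of_isInfix hcau hsuf.isInfix
    simp at this
    exact he.asymm this
  · obtain ⟨r, c, hr⟩ : ∃ r c, x' :: l.reverse = r ++ [c] :=
      ⟨_, _, (List.dropLast_append_getLast (List.cons_ne_nil _ _)).symm⟩
    exact ⟨c, y, r, [], by simp [hp, hr]⟩
  · rintro s ⟨r, hr⟩ hs w ⟨⟨a, b, hi⟩, -⟩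
    have hlen : s.length ≤ 2 := by
      by_contra! hlen
      have h2 := List.suffix_of_suffix_length_le hsuf ⟨r, hr⟩ (by simp; omega)
      obtain ⟨t, rfl⟩ := h2
      cases t with
      | nil => simp at hlen
      | cons z t =>
        simp at hs
        subst hs
        have := hnd.sublist (List.IsSuffix.sublist ⟨r, hr⟩)
        simp at this
    have := hi.length_le
    simp at this
    omega

theorem condC3_of_open (hXY : Disjoint X Y) {W : Set V} (hW : D.SatisfiesAC X Y W) {x y : V}
    {p : List V} (hx : x ∈ X) (hy : y ∈ Y) (hp : D.IsPathFrom p x y)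
    (hopen : ¬ D.Blocks (((D.AdjustSet X Y \ D.Desc X) ∪ X) \ {x}) p)
    (rest : List V) : ∀ (pre : List V) (a b : V), p = pre ++ a :: b :: rest →
      (D.Edge b a ∧ (a ∈ X ∨ (a ∈ D.AdjustSet X Y ∧ a ∈ D.Desc X ∧ a ∈ D.Anc X)) ∨
        D.Edge a b ∧ ∃ b₀ ∈ D.Desc X, b₀ ∈ D.Anc X ∧ b₀ ∉ X ∧
          ReflTransGen (fun a c => D.Edge a c ∧ c ∉ X) b₀ a) →
      D.CondC3 X Y := by
  obtain ⟨hnd, hch, hhd, hlast⟩ := hp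
  have toY : ∀ (a b : V), b ∈ Y →
      (D.Edge b a ∧ (a ∈ X ∨ (a ∈ D.AdjustSet X Y ∧ a ∈ D.Desc X ∧ a ∈ D.Anc X)) ∨
        D.Edge a b ∧ ∃ b₀ ∈ D.Desc X, b₀ ∈ D.Anc X ∧ b₀ ∉ X ∧
          ReflTransGen (fun a c => D.Edge a c ∧ c ∉ X) b₀ a) →
      D.CondC3 X Y := by
    intro a b hb h
    have hbX : b ∉ X := fun h => Set.disjoint_left.1 hXY h hb
    rcases h with ⟨he, ha | ⟨ha, haD, haA⟩⟩ | ⟨he, b₀, hD, hA, hX, hr⟩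
    · have := hW.2 [a, b] ⟨⟨a, ha, b, hb, ?_, ?_, rfl, rfl⟩, by simpa using hbX, ?_⟩
      · rcases this with ⟨w, ⟨⟨c, d, hi⟩, -⟩, -⟩ | ⟨w, ⟨c, d, hi, -⟩, -⟩ <;>
        · have := hi.length_le
          simp at this
      · have : a ≠ b := fun e => hbX (e ▸ ha)
        simpa using this
      · exact List.isChain_pair.2 (Or.inr he)
      · exact fun h => he.asymm (List.isChain_pair.1 h)
    · exact condC3_of_edge hXY ha haD haA hb he
    · exact (disjoint_forb_anc hW (mem_forb_of_desc hD hX hb (hr.tail ⟨he, hbX⟩)) hA).elim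
  have adj : ∀ b, b ∉ X → b ∉ Y → b ∈ D.Anc X → b ∈ D.AdjustSet X Y := by
    intro b hbX hbY hbA
    obtain ⟨x', hx', h⟩ := hbA
    refine ⟨⟨x', Or.inl hx', h⟩, ?_⟩
    rintro ((h' | h') | h')
    · exact hbX h'
    · exact hbY h'
    · exact disjoint_forb_anc hW h' ⟨x', hx', h⟩
  induction rest with
  | nil =>
    intro pre a b e h
    have : b = y := by
      rw [e] at hlast
      simpa using hlast
    exact toY a b (this ▸ hy) h
  | cons c rest ih =>
    intro pre a b e h
    by_cases hbY : b ∈ Y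
    · exact toY a b hbY h
    have hi : [a, b, c] <:+: p := ⟨pre, rest, by simp [e]⟩
    have e' : p = (pre ++ [a]) ++ b :: c :: rest := by simp [e]
    have hbx : b ≠ x := by
      rintro rfl
      have h1 := hnd
      rw [e] at h1 hhd
      cases pre with
      | nil =>
        simp at hhd
        simp [hhd] at h1
      | cons z pre =>
        simp at hhd
        simp [hhd] at h1
    have hnc : ¬ (D.Edge a b ∧ D.Edge c b) → b ∉ X ∧ (b ∈ D.AdjustSet X Y → b ∈ D.Desc X) := by
      intro hn
      have : b ∉ ((D.AdjustSet X Y \ D.Desc X) ∪ X) \ {x} := by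
        intro hb
        refine hopen (Or.inl ⟨b, ⟨⟨a, c, hi⟩, ?_⟩, hb⟩)
        rintro ⟨a', c', hi', hac⟩
        obtain ⟨rfl, rfl⟩ := neighbors_unique_of_nodup hnd hi hi'
        exact hn hac
      simp only [Set.mem_sdiff, Set.mem_union, Set.mem_singleton_iff] at this
      tauto
    have hcb : D.Edge b c ∨ D.Edge c b := by
      have := isChain_of_isInfix hch hi
      simp at this
      exact this.2
    rcases h with ⟨he, ha⟩ | ⟨he, b₀, hD, hA, hX, hr⟩
    · obtain ⟨hbX, hbZ⟩ := hnc fun h => he.asymm h.1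
      have hbA : b ∈ D.Anc X := by
        rcases ha with ha | ⟨-, -, x', hx', ha⟩
        · exact ⟨a, ha, .single he⟩
        · exact ⟨x', hx', .head he ha⟩
      have hbAdj := adj b hbX hbY hbA
      have hbD := hbZ hbAdj
      rcases hcb with hc | hc
      · exact ih _ b c e' (Or.inr ⟨hc, b, hbD, hbA, hbX, .refl⟩)
      · exact ih _ b c e' (Or.inl ⟨hc, Or.inr ⟨hbAdj, hbD, hbA⟩⟩)
    · by_cases hc : D.Edge c b
      · refine ih _ b c e' (Or.inl ⟨hc, ?_⟩)
        by_cases hbX : b ∈ X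
        · exact Or.inl hbX
        · have hbD : b ∈ D.Desc X := by
            obtain ⟨x', hx', h⟩ := hD
            exact ⟨x', hx', (h.trans (hr.lift id fun _ _ h => h.1)).tail he⟩
          have hne : (D.Desc {b} ∩ (((D.AdjustSet X Y \ D.Desc X) ∪ X) \ {x})).Nonempty :=
            Set.nonempty_iff_ne_empty.2 fun h =>
              hopen (Or.inr ⟨b, ⟨a, c, hi, he, hc⟩, h⟩)
          obtain ⟨d, ⟨b', hb', hd⟩, hdZ, -⟩ := hne
          rw [Set.mem_singleton_iff.1 hb'] at hd
          have hbA : b ∈ D.Anc X := by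
            rcases hdZ with ⟨-, hdD⟩ | hdX
            · obtain ⟨x', hx', h⟩ := hbD
              exact absurd ⟨x', hx', h.trans hd⟩ hdD
            · exact ⟨d, hdX, hd⟩
          exact Or.inr ⟨adj b hbX hbY hbA, hbD, hbA⟩
      · obtain ⟨hbX, -⟩ := hnc fun h => hc h.2
        exact ih _ b c e' (Or.inr ⟨hcb.resolve_right hc, b₀, hD, hA, hX, hr.tail ⟨he, hbX⟩⟩)

theorem not_genBackdoorCriterion_of_condC3 (h : D.CondC3 X Y) (Z : Set V) :
    ¬ D.GenBackdoorCriterion X Y Z := by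
  obtain ⟨x, hx, y, hy, p, v, hp, ⟨-, htail, -⟩, ⟨-, x', hx', hxv⟩, ⟨⟨a, b, hi⟩, -⟩, -, -,
    hrev, r, hr⟩ := h
  rintro ⟨hZ, hblock⟩
  have hcf := colliderFree_of_isChain_reverse hrev
  have hback : D.IsBackdoorFrom p x := by
    have hlen := hi.length_le
    have hhd := hp.2.2.1
    have hc := List.isChain_reverse.1 hrev
    match p, hlen, hhd, hc with
    | c :: d :: l, _, hhd, hc =>
      simp at hhd
      subst hhd
      exact ⟨d, l, rfl, (List.isChain_cons_cons.1 hc).1⟩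
  rcases hblock x hx y hy p hp hback with ⟨w, ⟨⟨c, d, hi'⟩, -⟩, hw, hwx⟩ | ⟨w, hw, -⟩
  · obtain ⟨s, t, e⟩ := hi'
    rcases hw with hw | hw
    · have hwr : w ∈ r ++ [v] := by
        have h1 : w ∈ p.dropLast := by
          rw [← e]
          cases t <;> simp [List.dropLast_append_of_ne_nil, List.dropLast]
        have h2 : p.dropLast = r ++ [v] := by
          rw [← hr]
          simp [List.dropLast_append_of_ne_nil, List.dropLast]
        exact h2 ▸ h1
      have hvw : ReflTransGen D.Edge v w := by
        have hpw := pairwise_transGen hrev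
        rw [← hr] at hpw
        simp at hpw
        rcases List.mem_append.1 hwr with h | h
        · exact (hpw.2.1 w h).to_reflTransGen
        · rw [List.mem_singleton.1 h]
      exact Set.eq_empty_iff_forall_notMem.1 hZ w ⟨hw, x', hx', hxv.trans hvw⟩
    · refine htail w ?_ hw
      rw [← e]
      cases s <;> simp
  · exact hcf w hw

end Auxiliary


/-- Assume some set disjoint from `X ∪ Y` satisfies the adjustment
criterion relative to `(X, Y)` in `D`.  Then there is no generalized back-door set
relative to `(X, Y)` in `D` iff condition (C3) holds. -/
theorem no_generalized_backdoor_set_characterization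
    (D : DAG V) (X Y : Set V)
    (hXY : Disjoint X Y) (hX : X.Nonempty) (hY : Y.Nonempty)
    (hexists : ∃ Z, Disjoint Z (X ∪ Y) ∧ D.SatisfiesAC X Y Z) :
    (¬ ∃ Z, D.GenBackdoorCriterion X Y Z) ↔ D.CondC3 X Y := by
  constructor
  · intro h
    obtain ⟨W, -, hW⟩ := hexists
    by_contra hC
    refine h ⟨D.AdjustSet X Y \ D.Desc X, ?_, ?_⟩
    · exact Set.eq_empty_iff_forall_notMem.2 fun _ hw => hw.1.2 hw.2
    · rintro x hx y hy p hp ⟨b, rest, e, he⟩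
      by_contra hopen
      exact hC (condC3_of_open hXY hW hx hy hp hopen rest [] x b e (Or.inl ⟨he, Or.inl hx⟩))
  · rintro h ⟨Z, hZ⟩
    exact not_genBackdoorCriterion_of_condC3 h Z hZ

end DAG
end

section
/- Let 𝐗 and 𝐘 be disjoint nonempty node sets in a DAG D. Consider the conditions: (C2) there is a proper non-causal path p from 𝐗 to 𝐘 in D such that every collider on p is in Adjust(𝐗,𝐘,D) and every non-collider on p is in forb(𝐗,𝐘,D); (C3) there exist X ∈ 𝐗, Y ∈ 𝐘, a path p from X to Y of the form X ← ⋯ ← V ← Y (p traversed from Y to X is directed and V is adjacent to Y on p) such that p is a proper non-causal path from 𝐗 to 𝐘, V ∈ Adjust(𝐗,𝐘,D) ∩ De(𝐗,D) and V is a non-collider on p, every collider on p is in Adjust(𝐗,𝐘,D) \ De(𝐗,D), and every non-collider on the subpath of p from V to Y is in forb(𝐗,𝐘,D); (C4) there exist X ∈ 𝐗, Y ∈ 𝐘 and a path p from X to Y whose first edge points into X, containing a node X'' ∈ 𝐗 with X'' ≠ X such that the subpath of p from X'' to Y is a proper causal path from 𝐗 to 𝐘, with no colliders on p and all nodes on p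 in De(𝐗,D). Then: (i) no set disjoint from 𝐗 ∪ 𝐘 satisfies the adjustment criterion relative to (𝐗,𝐘) in D if and only if (C2) holds; (ii) there is no generalized back-door set relative to (𝐗,𝐘) in D if and only if (C2) or (C3) holds; (iii) there is no back-door set relative to (𝐗,𝐘) in D if and only if (C2), (C3) or (C4) holds. -/
attribute [local instance] Classical.propDecidable

namespace DAG

variable {V : Type} [Fintype V] [DecidableEq V]

/-! ### Lists -/

section Lists

variable {α : Type*}

lemma triple_reverse {a w b : α} {p : List α} (h : [a, w, b] <:+: p) :
    [b, w, a] <:+: p.reverse := by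
  simpa using List.reverse_infix.2 h

lemma triple_unique {p : List α} (hp : p.Nodup) {a w b a' b' : α}
    (h : [a, w, b] <:+: p) (h' : [a', w, b'] <:+: p) : a = a' ∧ b = b' := by
  obtain ⟨s, t, rfl⟩ := h
  obtain ⟨s', t', e⟩ := h'
  have e1 : (s' ++ [a']) ++ w :: (b' :: t') = (s ++ [a]) ++ w :: (b :: t) := by simpa using e
  have n1 : ((s ++ [a]) ++ w :: (b :: t)).Nodup := by simpa using hp
  have n2 := n1
  rw [← e1] at n2
  have m1 : w ∉ s ++ [a] := fun h => by
    have := (List.nodup_append.1 n1).2.2 w h w (by simp)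
    exact this rfl
  have m2 : w ∉ s' ++ [a'] := fun h => by
    have := (List.nodup_append.1 n2).2.2 w h w (by simp)
    exact this rfl
  rcases List.append_eq_append_iff.1 e1 with ⟨as, h1, h2⟩ | ⟨as, h1, h2⟩ <;>
  · rcases as with _ | ⟨c, as⟩
    · simp_all
    · simp only [List.cons_append, List.cons.injEq] at h2
      exfalso
      simp_all

lemma triple_mem {p : List α} {a w b : α} (h : [a, w, b] <:+: p) :
    w ∈ p.tail ∧ w ∈ p.dropLast := by
  obtain ⟨s, t, rfl⟩ := h
  constructor
  · rcases s with _ | ⟨c, s⟩ <;> simp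
  · have : s ++ [a, w, b] ++ t = (s ++ [a, w]) ++ (b :: t) := by simp
    rw [this, List.dropLast_append_of_ne_nil (by simp)]
    simp

lemma exists_first {p : List α} {P : α → Prop} (h : ∃ v ∈ p, P v) :
    ∃ l₁ v l₂, p = l₁ ++ v :: l₂ ∧ P v ∧ ∀ u ∈ l₁, ¬ P u := by
  induction p with
  | nil => simp at h
  | cons a p ih =>
    by_cases ha : P a
    · exact ⟨[], a, p, rfl, ha, by simp⟩
    · obtain ⟨l₁, v, l₂, rfl, hv, hl⟩ := ih (by simpa [ha] using h)
      exact ⟨a :: l₁, v, l₂, rfl, hv, by simpa [ha] using hl⟩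

lemma exists_last {p : List α} {P : α → Prop} (h : ∃ v ∈ p, P v) :
    ∃ l₁ v l₂, p = l₁ ++ v :: l₂ ∧ P v ∧ ∀ u ∈ l₂, ¬ P u := by
  obtain ⟨l₁, v, l₂, e, hv, hl⟩ := exists_first (p := p.reverse) (by simpa using h)
  refine ⟨l₂.reverse, v, l₁.reverse, ?_, hv, by simpa using hl⟩
  simpa using congrArg List.reverse e

lemma mem_tail_of_isPrefix {p q : List α} (h : p <+: q) {v : α} (hv : v ∈ p.tail) :
    v ∈ q.tail := by
  obtain ⟨t, rfl⟩ := h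
  rcases p with _ | ⟨a, p⟩ <;> simp_all

end Lists

lemma edge_asymm (D : DAG V) {a b : V} (h : D.Edge a b) : ¬ D.Edge b a :=
  fun h' => D.acyclic a (.tail (.single h) h')

lemma Adj.symm {D : DAG V} {a b : V} (h : D.Adj a b) : D.Adj b a := Or.symm h

/-- The triple `a, w, b` does not block a path given `Z`. -/
def OpenAt (D : DAG V) (Z : Set V) (a w b : V) : Prop :=
  (D.Edge a w ∧ D.Edge b w → w ∈ D.Anc Z) ∧ (¬ (D.Edge a w ∧ D.Edge b w) → w ∉ Z)

/-- Every triple of consecutive nodes of `p` is open given `Z`. -/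
def IsOpen (D : DAG V) (Z : Set V) (p : List V) : Prop :=
  ∀ a w b, [a, w, b] <:+: p → D.OpenAt Z a w b

lemma OpenAt.symm {D : DAG V} {Z : Set V} {a w b : V} (h : D.OpenAt Z a w b) :
    D.OpenAt Z b w a :=
  ⟨fun h' => h.1 h'.symm, fun h' => h.2 fun h'' => h' h''.symm⟩

lemma subset_anc (D : DAG V) (S : Set V) : S ⊆ D.Anc S := fun v hv => ⟨v, hv, .refl⟩

lemma subset_desc (D : DAG V) (S : Set V) : S ⊆ D.Desc S := fun v hv => ⟨v, hv, .refl⟩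

lemma anc_mono (D : DAG V) {S T : Set V} (h : S ⊆ T) : D.Anc S ⊆ D.Anc T :=
  fun _ ⟨w, hw, r⟩ => ⟨w, h hw, r⟩

lemma mem_anc_of_reach {D : DAG V} {S : Set V} {u v : V}
    (h : Relation.ReflTransGen D.Edge u v) : v ∈ D.Anc S → u ∈ D.Anc S :=
  fun ⟨w, hw, r⟩ => ⟨w, hw, h.trans r⟩

lemma mem_desc_of_reach {D : DAG V} {S : Set V} {u v : V}
    (h : Relation.ReflTransGen D.Edge u v) : u ∈ D.Desc S → v ∈ D.Desc S :=
  fun ⟨w, hw, r⟩ => ⟨w, hw, r.trans h⟩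

lemma mem_forb_of_reach {D : DAG V} {X Y : Set V} {u v : V}
    (h : Relation.ReflTransGen D.Edge u v) : u ∈ D.Forb X Y → v ∈ D.Forb X Y :=
  fun ⟨p, w, hp, hw, hX, r⟩ => ⟨p, w, hp, hw, hX, r.trans h⟩

/-! ### Open paths -/

lemma IsOpen.of_isInfix {D : DAG V} {Z : Set V} {p q : List V} (h : D.IsOpen Z p) (hq : q <:+: p) :
    D.IsOpen Z q := fun a w b ht => h a w b (ht.trans hq)

lemma IsOpen.reverse {D : DAG V} {Z : Set V} {p : List V} (h : D.IsOpen Z p) :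
    D.IsOpen Z p.reverse := fun a w b ht => by
  have := triple_reverse ht
  rw [List.reverse_reverse] at this
  exact (h _ _ _ this).symm

lemma isColliderOn_iff (D : DAG V) {p : List V} (hp : p.Nodup) {a w b : V}
    (h : [a, w, b] <:+: p) : D.IsColliderOn p w ↔ D.Edge a w ∧ D.Edge b w := by
  constructor
  · rintro ⟨a', b', h', e⟩
    obtain ⟨rfl, rfl⟩ := triple_unique hp h h'
    exact e
  · exact fun e => ⟨a, b, h, e⟩

lemma not_blocks_iff (D : DAG V) {Z : Set V} {p : List V} (hp : p.Nodup) :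
    ¬ D.Blocks Z p ↔ D.IsOpen Z p := by
  have key (w : V) : D.Desc {w} ∩ Z = ∅ ↔ w ∉ D.Anc Z := by
    rw [Set.eq_empty_iff_forall_notMem]
    constructor
    · rintro h ⟨z, hz, r⟩
      exact h z ⟨⟨w, rfl, r⟩, hz⟩
    · rintro h z ⟨⟨w', rfl, r⟩, hz⟩
      exact h ⟨z, hz, r⟩
  constructor
  · intro h a w b ht
    constructor
    · intro e
      by_contra hw
      exact h (Or.inr ⟨w, ⟨a, b, ht, e⟩, (key w).2 hw⟩)
    · intro e hw
      exact h (Or.inl ⟨w, ⟨⟨a, b, ht⟩, fun hc => e ((D.isColliderOn_iff hp ht).1 hc)⟩, hw⟩)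
  · rintro h (⟨w, ⟨⟨a, b, ht⟩, hc⟩, hw⟩ | ⟨w, ⟨a, b, ht, e⟩, hw⟩)
    · exact (h a w b ht).2 (fun e => hc ((D.isColliderOn_iff hp ht).2 e)) hw
    · exact (key w).1 hw ((h a w b ht).1 e)

/-! ### Directed paths and colliders -/

/-- A path has no collider. -/
def NoCollider (D : DAG V) (p : List V) : Prop :=
  ∀ a w b, [a, w, b] <:+: p → ¬ (D.Edge a w ∧ D.Edge b w)

lemma causal_or_collider (D : DAG V) (l : List V) : ∀ {a b : V},
    (a :: b :: l).IsChain D.Adj → D.Edge a b →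
    (a :: b :: l).IsChain D.Edge ∨
      ∃ u c v, [u, c, v] <:+: a :: b :: l ∧ D.Edge u c ∧ D.Edge v c ∧
        Relation.ReflTransGen D.Edge b c := by
  induction l with
  | nil => intro a b _ e; exact Or.inl (by simpa using e)
  | cons c l ih =>
    intro a b h e
    have h' := (List.isChain_cons_cons.1 h).2
    rcases (List.isChain_cons_cons.1 h').1 with e' | e'
    · rcases ih h' e' with h1 | ⟨u, d, v, ht, e1, e2, r⟩
      · exact Or.inl (List.isChain_cons_cons.2 ⟨e, h1⟩)
      · exact Or.inr ⟨u, d, v, ht.trans (List.suffix_cons _ _).isInfix, e1, e2, .head e' r⟩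
    · exact Or.inr ⟨a, b, c, ⟨[], l, by simp⟩, e, e', .refl⟩

lemma reach_of_causal (D : DAG V) {l : List V} : ∀ {a v : V}, (a :: l).IsChain D.Edge →
    v ∈ a :: l → Relation.ReflTransGen D.Edge a v := by
  induction l with
  | nil => intro a v _ h; simp at h; subst h; exact .refl
  | cons b l ih =>
    intro a v h hv
    obtain ⟨e, h'⟩ := List.isChain_cons_cons.1 h
    rcases List.mem_cons.1 hv with rfl | hv
    · exact .refl
    · exact .head e (ih h' hv)

lemma nodup_of_causal (D : DAG V) {l : List V} (h : l.IsChain D.Edge) : l.Nodup := by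
  have h1 : l.IsChain (Relation.TransGen D.Edge) := h.imp fun _ _ e => .single e
  refine (List.isChain_iff_pairwise.1 h1).imp ?_
  rintro a _ r rfl
  exact D.acyclic a r

/-- A path without colliders that starts against an arrow is either directed towards its
start or has a source in its interior. -/
lemma reverse_causal_or_source (D : DAG V) (l : List V) : ∀ {a b : V},
    (a :: b :: l).IsChain D.Adj → D.NoCollider (a :: b :: l) → D.Edge b a →
    (a :: b :: l).IsChain (fun u v => D.Edge v u) ∨
      ∃ l₁ t l₂, a :: b :: l = a :: l₁ ++ t :: l₂ ∧ l₂ ≠ [] ∧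
        (a :: l₁ ++ [t]).IsChain (fun u v => D.Edge v u) ∧ (t :: l₂).IsChain D.Edge := by
  induction l with
  | nil => intro a b _ _ e; exact Or.inl (by simpa using e)
  | cons c l ih =>
    intro a b h hn e
    have h' := (List.isChain_cons_cons.1 h).2
    have hn' : D.NoCollider (b :: c :: l) := fun u w v ht =>
      hn u w v (ht.trans (List.suffix_cons _ _).isInfix)
    rcases (List.isChain_cons_cons.1 h').1 with e' | e'
    · right
      refine ⟨[], b, c :: l, rfl, by simp, by simpa using e, ?_⟩
      rcases D.causal_or_collider l h' e' with h1 | ⟨u, d, v, ht, e1, e2, r⟩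
      · exact h1
      · exact absurd ⟨e1, e2⟩ (hn' _ _ _ ht)
    · rcases ih h' hn' e' with h1 | ⟨l₁, t, l₂, heq, hne, h1, h2⟩
      · exact Or.inl (List.isChain_cons_cons.2 ⟨e, h1⟩)
      · refine Or.inr ⟨b :: l₁, t, l₂, by simpa using heq, hne, ?_, h2⟩
        exact List.isChain_cons_cons.2 ⟨e, h1⟩

lemma mem_anc_of_triple (D : DAG V) {p : List V} (hp : p.IsChain D.Adj) {x y a w b : V}
    (hx : p.head? = some x) (hy : p.getLast? = some y) (ht : [a, w, b] <:+: p)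
    (hw : ¬ (D.Edge a w ∧ D.Edge b w)) {S : Set V} (hxS : x ∈ S) (hyS : y ∈ S)
    (hS : ∀ u c v, [u, c, v] <:+: p → D.Edge u c → D.Edge v c → c ∈ D.Anc S) :
    w ∈ D.Anc S := by
  have fwd : ∀ (q : List V) (y a w b : V), q.IsChain D.Adj → q.getLast? = some y →
      [a, w, b] <:+: q → D.Edge w b → y ∈ S →
      (∀ u c v, [u, c, v] <:+: q → D.Edge u c → D.Edge v c → c ∈ D.Anc S) → w ∈ D.Anc S := by
    rintro q y a w b hq hy ⟨s, t, rfl⟩ e hyS hS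
    have hsuf : w :: b :: t <:+ s ++ [a, w, b] ++ t := ⟨s ++ [a], by simp⟩
    rcases D.causal_or_collider t (hq.suffix hsuf) e with h1 | ⟨u, c, v, h1, e1, e2, r⟩
    · refine ⟨y, hyS, D.reach_of_causal h1 (List.mem_of_getLast? ?_)⟩
      simpa [List.getLast?_append, List.getLast?_cons] using hy
    · exact mem_anc_of_reach (.head e r) (hS u c v (h1.trans hsuf.isInfix) e1 e2)
  have hadj : D.Adj a w ∧ D.Adj w b := by simpa using hp.infix ht
  by_cases e : D.Edge w b
  · exact fwd p y a w b hp hy ht e hyS hS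
  · have e' : D.Edge w a := by
      rcases hadj with ⟨h1 | h1, h2 | h2⟩
      · exact absurd h2 e
      · exact absurd ⟨h1, h2⟩ hw
      · exact h1
      · exact h1
    refine fwd p.reverse x b w a ?_ (by simpa using hx) (triple_reverse ht) e' hxS ?_
    · exact List.isChain_reverse.2 (hp.imp fun _ _ h => h.symm)
    · intro u c v h e1 e2
      have := triple_reverse h
      rw [List.reverse_reverse] at this
      exact hS v c u this e2 e1

/-! ### Constructing open paths -/

/-- `D.OpenFrom X Z q`: the list `q`, read backwards, is an open path given `Z` that starts in `X`
and does not return to `X`. -/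
inductive OpenFrom (D : DAG V) (X Z : Set V) : List V → Prop
  | start {x : V} : x ∈ X → OpenFrom D X Z [x]
  | second {x u : V} : x ∈ X → u ∉ X → D.Adj u x → OpenFrom D X Z [u, x]
  | step {u v w : V} {l : List V} : OpenFrom D X Z (v :: w :: l) → u ∉ X → u ∉ v :: w :: l →
      D.Adj u v → D.OpenAt Z u v w → OpenFrom D X Z (u :: v :: w :: l)

/-- The path ending in `v :: l` (read backwards) enters `v` along an edge into `v`. -/
def EntersBy (D : DAG V) (v : V) : List V → Prop
  | [] => False
  | w :: _ => D.Edge w v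

/-- The path ending in `v :: l` (read backwards) enters `v` against an edge out of `v`, or
starts there. -/
def EntersAgainst (D : DAG V) (v : V) : List V → Prop
  | [] => True
  | w :: _ => D.Edge v w

namespace OpenFrom

variable {D : DAG V} {X Z : Set V}

lemma of_suffix {q : List V} (h : D.OpenFrom X Z q) :
    ∀ {r : List V}, r <:+ q → r ≠ [] → D.OpenFrom X Z r := by
  induction h with
  | start hx =>
    intro r hr hne
    rcases List.suffix_cons_iff.1 hr with rfl | hr
    · exact .start hx
    · exact absurd (List.suffix_nil.1 hr) hne
  | second hx hu ha =>
    intro r hr hne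
    rcases List.suffix_cons_iff.1 hr with rfl | hr
    · exact .second hx hu ha
    rcases List.suffix_cons_iff.1 hr with rfl | hr
    · exact .start hx
    · exact absurd (List.suffix_nil.1 hr) hne
  | step h hu hn ha ho ih =>
    intro r hr hne
    rcases List.suffix_cons_iff.1 hr with rfl | hr
    · exact .step h hu hn ha ho
    · exact ih hr hne

lemma adj {v w : V} {l : List V} (h : D.OpenFrom X Z (v :: w :: l)) : D.Adj v w := by
  cases h <;> assumption

lemma extend {u v : V} {l : List V} (h : D.OpenFrom X Z (v :: l)) (hu : u ∉ X)
    (hn : u ∉ v :: l) (ha : D.Adj u v) (ho : ∀ w l', l = w :: l' → D.OpenAt Z u v w) :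
    D.OpenFrom X Z (u :: v :: l) := by
  rcases l with _ | ⟨w, l⟩
  · cases h with
    | start hx => exact .second hx hu ha
  · exact .step h hu hn ha (ho w l rfl)

/-- Facts about an earlier node `u` of an open path. -/
lemma earlier {q : List V} (h : D.OpenFrom X Z q) : ∀ {u v : V} {l l₂ : List V},
    q = v :: l → u :: l₂ <:+ l → D.EntersAgainst u l₂ ∨ u ∈ D.Anc Z ∨
      (Relation.ReflTransGen D.Edge u v ∧ D.EntersBy v l) := by
  induction h with
  | start hx =>
    rintro u v l l₂ ⟨⟩ hs
    simp at hs
  | second hx hu ha =>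
    rintro u v l l₂ ⟨⟩ hs
    rcases List.suffix_cons_iff.1 hs with e | hs
    · obtain ⟨rfl, rfl⟩ := List.cons.inj e
      exact Or.inl trivial
    · simp at hs
  | @step u' v' w' l' h hu hn ha ho ih =>
    rintro u v l l₂ ⟨⟩ hs
    rcases List.suffix_cons_iff.1 hs with e | hs
    · obtain ⟨rfl, rfl⟩ := List.cons.inj e
      rcases h.adj with e1 | e1
      · exact Or.inl e1
      · rcases ha with e2 | e2
        · exact Or.inr (Or.inl (ho.1 ⟨e2, e1⟩))
        · exact Or.inr (Or.inr ⟨.single e2, e2⟩)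
    · rcases ih rfl hs with h1 | h1 | ⟨r, e1⟩
      · exact Or.inl h1
      · exact Or.inr (Or.inl h1)
      · rcases ha with e2 | e2
        · exact Or.inr (Or.inl (mem_anc_of_reach r (ho.1 ⟨e2, e1⟩)))
        · exact Or.inr (Or.inr ⟨r.tail e2, e2⟩)

lemma earlier_notMem {q : List V} (h : D.OpenFrom X Z q) (hXZ : Disjoint X Z) :
    ∀ {u v : V} {l l₂ : List V}, q = v :: l → u :: l₂ <:+ l → D.EntersBy u l₂ ∨ u ∉ Z := by
  induction h with
  | start hx =>
    rintro u v l l₂ ⟨⟩ hs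
    simp at hs
  | second hx hu ha =>
    rintro u v l l₂ ⟨⟩ hs
    rcases List.suffix_cons_iff.1 hs with e | hs
    · obtain ⟨rfl, rfl⟩ := List.cons.inj e
      exact Or.inr (Set.disjoint_left.1 hXZ hx)
    · simp at hs
  | @step u' v' w' l' h hu hn ha ho ih =>
    rintro u v l l₂ ⟨⟩ hs
    rcases List.suffix_cons_iff.1 hs with e | hs
    · obtain ⟨rfl, rfl⟩ := List.cons.inj e
      rcases h.adj with e1 | e1
      · exact Or.inr (ho.2 fun h' => D.edge_asymm e1 h'.2)
      · exact Or.inl e1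
    · exact ih rfl hs

end OpenFrom

/-- Some open path from `X` to `v` can be continued along an edge into `v`, whenever `v ∉ Z`. -/
def ReachedUp (D : DAG V) (X Z : Set V) (v : V) : Prop :=
  ∃ l, D.OpenFrom X Z (v :: l) ∧ (D.EntersAgainst v l ∨ v ∈ D.Anc Z)

/-- Some open path from `X` to `v` can be continued against an edge into `v`, if `v` is an
ancestor of `Z`, and along an edge out of `v`, if `v ∉ Z`. -/
def ReachedDown (D : DAG V) (X Z : Set V) (v : V) : Prop :=
  ∃ l, D.OpenFrom X Z (v :: l) ∧ (D.EntersBy v l ∨ v ∉ Z)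

section Reached

variable {D : DAG V} {X Z : Set V}

lemma ReachedUp.start {x : V} (hx : x ∈ X) : D.ReachedUp X Z x :=
  ⟨[], .start hx, Or.inl trivial⟩

lemma reachedUp_of_extend {u v : V} {l : List V} (h : D.OpenFrom X Z (v :: l)) (e : D.Edge u v)
    (ho : ∀ w l', l = w :: l' → D.OpenAt Z u v w) (hv : D.EntersBy v l → v ∈ D.Anc Z) :
    D.ReachedUp X Z u := by
  by_cases hu : u ∈ X
  · exact .start hu
  by_cases hn : u ∈ v :: l
  · obtain ⟨l₁, l₂, hl⟩ := List.mem_iff_append.1 hn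
    have hs : u :: l₂ <:+ v :: l := ⟨l₁, hl.symm⟩
    rcases List.suffix_cons_iff.1 hs with e' | hs'
    · obtain ⟨rfl, rfl⟩ := List.cons.inj e'
      exact absurd e (D.edge_asymm e)
    refine ⟨l₂, h.of_suffix hs (by simp), ?_⟩
    rcases h.earlier rfl hs' with h1 | h1 | ⟨r, h1⟩
    · exact Or.inl h1
    · exact Or.inr h1
    · exact Or.inr (mem_anc_of_reach r (hv h1))
  · exact ⟨v :: l, h.extend hu hn (Or.inl e) ho, Or.inl e⟩

lemma ReachedUp.up {u v : V} (h : D.ReachedUp X Z v) (hv : v ∉ Z) (e : D.Edge u v) :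
    D.ReachedUp X Z u := by
  obtain ⟨l, h, h1⟩ := h
  have key : D.EntersBy v l → v ∈ D.Anc Z := by
    intro h2
    rcases h1 with h1 | h1
    · rcases l with _ | ⟨w, l⟩
      · exact h2.elim
      · exact absurd h2 (D.edge_asymm h1)
    · exact h1
  refine reachedUp_of_extend h e ?_ key
  rintro w l' rfl
  exact ⟨fun h' => key h'.2, fun _ => hv⟩

lemma ReachedDown.up {u v : V} (h : D.ReachedDown X Z v) (hv : v ∈ D.Anc Z) (e : D.Edge u v) :
    D.ReachedUp X Z u := by
  obtain ⟨l, h, h1⟩ := h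
  refine reachedUp_of_extend h e ?_ fun _ => hv
  rintro w l' rfl
  exact ⟨fun _ => hv, fun h' => h1.resolve_left fun e' => h' ⟨e, e'⟩⟩

lemma reachedDown_of_edge (hXZ : Disjoint X Z) {u v : V} {l : List V}
    (h : D.OpenFrom X Z (v :: l)) (hv : v ∉ Z) (e : D.Edge v u) : D.ReachedDown X Z u := by
  by_cases hu : u ∈ X
  · exact ⟨[], .start hu, Or.inr (Set.disjoint_left.1 hXZ hu)⟩
  by_cases hn : u ∈ v :: l
  · obtain ⟨l₁, l₂, hl⟩ := List.mem_iff_append.1 hn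
    have hs : u :: l₂ <:+ v :: l := ⟨l₁, hl.symm⟩
    rcases List.suffix_cons_iff.1 hs with e' | hs'
    · obtain ⟨rfl, rfl⟩ := List.cons.inj e'
      exact absurd e (D.edge_asymm e)
    exact ⟨l₂, h.of_suffix hs (by simp), h.earlier_notMem hXZ rfl hs'⟩
  · refine ⟨v :: l, h.extend hu hn (Or.inr e) ?_, Or.inl e⟩
    exact fun w l' _ => ⟨fun h' => absurd h'.1 (D.edge_asymm e), fun _ => hv⟩

lemma reachedUp_of_mem_anc {v : V} (hv : v ∈ D.Anc X) (hvZ : v ∉ D.Anc Z) :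
    D.ReachedUp X Z v := by
  obtain ⟨x, hx, r⟩ := hv
  induction r using Relation.ReflTransGen.head_induction_on with
  | refl => exact .start hx
  | head e r ih =>
    have hc : _ ∉ D.Anc Z := fun h => hvZ (mem_anc_of_reach (.single e) h)
    exact (ih hc).up (fun h => hc (D.subset_anc Z h)) e

lemma OpenFrom.exists_of_reach (hXZ : Disjoint X Z) {v y : V} {l : List V}
    (h : D.OpenFrom X Z (v :: l)) (r : Relation.ReflTransGen D.Edge v y) (hv : v ∉ D.Anc Z) :
    ∃ l', D.OpenFrom X Z (y :: l') := by
  induction r using Relation.ReflTransGen.head_induction_on generalizing l with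
  | refl => exact ⟨l, h⟩
  | head e r ih =>
    obtain ⟨l', h', -⟩ := reachedDown_of_edge hXZ h (fun h' => hv (D.subset_anc Z h')) e
    exact ih h' fun h'' => hv (mem_anc_of_reach (.single e) h'')

/-- If the non-colliders of a path from `X` to `Y` avoid `Z` and its colliders are ancestors of
`X ∪ Y ∪ Z`, then there is an open path given `Z` from `X` to `Y`. -/
lemma exists_openFrom {Y : Set V} (hXZ : Disjoint X Z) {q : List V} {x y : V}
    (hq : q.IsChain D.Adj) (hhead : q.head? = some y) (hlast : q.getLast? = some x)
    (hx : x ∈ X) (hy : y ∈ Y)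
    (ho : ∀ a w b, [a, w, b] <:+: q →
      (D.Edge a w ∧ D.Edge b w → w ∈ D.Anc (X ∪ Y ∪ Z)) ∧
      (¬ (D.Edge a w ∧ D.Edge b w) → w ∉ Z)) :
    ∃ y' ∈ Y, ∃ l, D.OpenFrom X Z (y' :: l) := by
  by_contra hcon
  have hcon' : ∀ y' ∈ Y, ∀ l, ¬ D.OpenFrom X Z (y' :: l) := fun y' h' l hl =>
    hcon ⟨y', h', l, hl⟩
  have key : ∀ (l : List V) (v : V), v :: l <:+ q →
      (D.EntersBy v l → D.ReachedDown X Z v) ∧ (D.EntersAgainst v l → D.ReachedUp X Z v) := by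
    intro l
    induction l with
    | nil =>
      intro v hs
      have hv : v = x := by
        obtain ⟨s, rfl⟩ := hs
        simpa using hlast
      subst hv
      exact ⟨fun h => h.elim, fun _ => .start hx⟩
    | cons v l ih =>
      intro u hs
      have hs' : v :: l <:+ q := (List.suffix_cons _ _).trans hs
      obtain ⟨ihd, ihu⟩ := ih v hs'
      have hch := hq.suffix hs
      rcases l with _ | ⟨w, l⟩
      · have hv : v = x := by
          obtain ⟨s, rfl⟩ := hs'
          simpa using hlast
        subst hv
        refine ⟨fun e => ?_, fun e => (ihu trivial).up (Set.disjoint_left.1 hXZ hx) e⟩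
        exact reachedDown_of_edge hXZ (.start hx) (Set.disjoint_left.1 hXZ hx) e
      · have ht := ho u v w (List.IsInfix.trans ⟨[], l, by simp⟩ hs.isInfix)
        have hvw : D.Adj v w := by
          simpa using (hch.infix (⟨[u], l, by simp⟩ : [v, w] <:+: u :: v :: w :: l))
        constructor
        · intro e
          have hvZ := ht.2 fun h' => D.edge_asymm e h'.1
          rcases hvw with e' | e'
          · obtain ⟨l', h', -⟩ := ihu e'
            exact reachedDown_of_edge hXZ h' hvZ e
          · obtain ⟨l', h', -⟩ := ihd e'
            exact reachedDown_of_edge hXZ h' hvZ e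
        · intro e
          rcases hvw with e' | e'
          · exact (ihu e').up (ht.2 fun h' => D.edge_asymm e' h'.2) e
          · by_cases hvZ : v ∈ D.Anc Z
            · exact (ihd e').up hvZ e
            · have hvZ' : v ∉ Z := fun h => hvZ (D.subset_anc Z h)
              obtain ⟨t, (ht' | ht') | ht', r⟩ := ht.1 ⟨e, e'⟩
              · exact (reachedUp_of_mem_anc ⟨t, ht', r⟩ hvZ).up hvZ' e
              · obtain ⟨l', h', -⟩ := ihd e'
                obtain ⟨l'', h''⟩ := h'.exists_of_reach hXZ r hvZ
                exact absurd h'' (hcon' t ht' l'')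
              · exact absurd ⟨t, ht', r⟩ hvZ
  rcases q with _ | ⟨v, l⟩
  · simp at hhead
  · obtain rfl : v = y := by simpa using hhead
    obtain ⟨hd, hu⟩ := key l v List.suffix_rfl
    rcases l with _ | ⟨w, l⟩
    · obtain ⟨l', h', -⟩ := hu trivial
      exact hcon' v hy l' h'
    · rcases (List.isChain_cons_cons.1 hq).1 with e | e
      · obtain ⟨l', h', -⟩ := hu e
        exact hcon' v hy l' h'
      · obtain ⟨l', h', -⟩ := hd e
        exact hcon' v hy l' h'

lemma OpenFrom.isChain {q : List V} (h : D.OpenFrom X Z q) : q.IsChain D.Adj := by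
  induction h with
  | start hx => simp
  | second hx hu ha => simpa using ha
  | step h hu hn ha ho ih => exact List.isChain_cons_cons.2 ⟨ha, ih⟩

lemma OpenFrom.nodup {q : List V} (h : D.OpenFrom X Z q) : q.Nodup := by
  induction h with
  | start hx => simp
  | second hx hu ha =>
    rw [List.nodup_cons]
    refine ⟨?_, by simp⟩
    rintro h
    rw [List.mem_singleton] at h
    exact hu (h ▸ hx)
  | step h hu hn ha ho ih => exact List.nodup_cons.2 ⟨hn, ih⟩

lemma OpenFrom.isOpen {q : List V} (h : D.OpenFrom X Z q) : D.IsOpen Z q := by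
  induction h with
  | start hx =>
    intro a w b ht
    simpa using ht.length_le
  | second hx hu ha =>
    intro a w b ht
    simpa using ht.length_le
  | step h hu hn ha ho ih =>
    intro a w b ht
    rcases List.infix_cons_iff.1 ht with h1 | h1
    · obtain ⟨t, h1⟩ := h1
      simp only [List.cons_append, List.cons.injEq] at h1
      obtain ⟨rfl, rfl, rfl, -⟩ := h1
      exact ho
    · exact ih a w b h1

lemma OpenFrom.exists_start {q : List V} (h : D.OpenFrom X Z q) :
    ∃ x ∈ X, ∃ l, q = l ++ [x] ∧ ∀ v ∈ l, v ∉ X := by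
  induction h with
  | start hx => exact ⟨_, hx, [], rfl, by simp⟩
  | @second x u hx hu ha => exact ⟨x, hx, [u], rfl, by simpa using hu⟩
  | @step u v w l h hu hn ha ho ih =>
    obtain ⟨x, hx, l', e, hl⟩ := ih
    exact ⟨x, hx, u :: l', by simp [e], by simpa using ⟨hu, hl⟩⟩

/-- If the non-colliders of a path from `X` to `Y` avoid `Z` and its colliders are ancestors of
`X ∪ Y ∪ Z`, then there is a proper open path given `Z` from `X` to `Y`. -/
lemma exists_proper_isOpen {Y : Set V} (hXZ : Disjoint X Z) {p : List V} {x y : V}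
    (hp : D.IsPathFrom p x y) (hx : x ∈ X) (hy : y ∈ Y)
    (ho : ∀ a w b, [a, w, b] <:+: p →
      (D.Edge a w ∧ D.Edge b w → w ∈ D.Anc (X ∪ Y ∪ Z)) ∧
      (¬ (D.Edge a w ∧ D.Edge b w) → w ∉ Z)) :
    ∃ x' ∈ X, ∃ y' ∈ Y, ∃ p', D.IsPathFrom p' x' y' ∧ (∀ v ∈ p'.tail, v ∉ X) ∧
      D.IsOpen Z p' := by
  obtain ⟨-, hch, hhead, hlast⟩ := hp
  obtain ⟨y', hy', l, h⟩ := exists_openFrom (D := D) (q := p.reverse) (x := x) (y := y) hXZ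
    (List.isChain_reverse.2 (List.IsChain.imp (fun _ _ h => h.symm) hch))
    (by simpa using hlast) (by simpa using hhead) hx hy (fun a w b ht => by
      have := triple_reverse ht
      rw [List.reverse_reverse] at this
      have h1 := ho b w a this
      exact ⟨fun h => h1.1 h.symm, fun h => h1.2 fun h' => h h'.symm⟩)
  obtain ⟨x', hx', l', e, hl⟩ := h.exists_start
  refine ⟨x', hx', y', hy', (y' :: l).reverse, ⟨?_, ?_, ?_, ?_⟩, ?_, h.isOpen.reverse⟩
  · exact List.nodup_reverse.2 h.nodup
  · exact List.isChain_reverse.2 (h.isChain.imp fun _ _ h => h.symm)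
  · rw [e]; simp
  · simp
  · rw [e]; simpa using hl

end Reached

/-! ### Deleting edges -/

/-- The DAG obtained from `D` by keeping only the edges that satisfy `P`. -/
def restrict (D : DAG V) (P : V → V → Prop) : DAG V where
  Edge a b := D.Edge a b ∧ P a b
  acyclic v h := D.acyclic v (Relation.TransGen.mono (fun _ _ h => h.1) _ _ h)

section Restrict

variable {D : DAG V} {P : V → V → Prop}

lemma restrict_edge {a b : V} : (D.restrict P).Edge a b ↔ D.Edge a b ∧ P a b := Iff.rfl

lemma adj_of_restrict {a b : V} (h : (D.restrict P).Adj a b) : D.Adj a b :=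
  h.imp (fun e => (restrict_edge.1 e).1) fun e => (restrict_edge.1 e).1

lemma restrict_edge_iff {a b : V} (h : (D.restrict P).Adj a b) :
    (D.restrict P).Edge a b ↔ D.Edge a b := by
  refine ⟨fun e => (restrict_edge.1 e).1, fun e => ?_⟩
  rcases h with h | h
  · exact h
  · exact absurd (restrict_edge.1 h).1 (D.edge_asymm e)

lemma restrict_collider_iff {p : List V} (hp : p.IsChain (D.restrict P).Adj) {a w b : V}
    (ht : [a, w, b] <:+: p) : (D.restrict P).Edge a w ∧ (D.restrict P).Edge b w ↔
      D.Edge a w ∧ D.Edge b w := by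
  have h : (D.restrict P).Adj a w ∧ (D.restrict P).Adj w b := by simpa using hp.infix ht
  rw [restrict_edge_iff h.1, restrict_edge_iff h.2.symm]

lemma restrict_anc_subset (S : Set V) : (D.restrict P).Anc S ⊆ D.Anc S :=
  fun _ ⟨w, hw, r⟩ => ⟨w, hw, Relation.ReflTransGen.mono (fun _ _ h => (restrict_edge.1 h).1) _ _ r⟩

lemma anc_subset_restrict {X S : Set V} (hP : ∀ a b, a ∉ X → P a b) (hXS : X ⊆ S) :
    D.Anc S ⊆ (D.restrict P).Anc S := by
  rintro v ⟨w, hw, r⟩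
  induction r using Relation.ReflTransGen.head_induction_on with
  | refl => exact subset_anc _ _ hw
  | @head a c e r ih =>
    by_cases ha : a ∈ X
    · exact subset_anc _ _ (hXS ha)
    · exact mem_anc_of_reach (.single (restrict_edge.2 ⟨e, hP a c ha⟩)) ih

lemma isChain_restrict {X : Set V} (hP : ∀ a b, a ∉ X → P a b) {x b : V} {l : List V}
    (h : (x :: b :: l).IsChain D.Adj) (hl : ∀ v ∈ b :: l, v ∉ X) (hb : D.Edge x b → P x b) :
    (x :: b :: l).IsChain (D.restrict P).Adj := by
  have aux : ∀ l : List V, l.IsChain D.Adj → (∀ v ∈ l, v ∉ X) →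
      l.IsChain (D.restrict P).Adj := by
    intro l
    induction l with
    | nil => simp
    | cons a l ih =>
      intro h hl
      rcases l with _ | ⟨c, l⟩
      · simp
      · obtain ⟨h1, h2⟩ := List.isChain_cons_cons.1 h
        refine List.isChain_cons_cons.2 ⟨h1.imp (fun e => restrict_edge.2 ⟨e, hP _ _ (hl _ (by simp))⟩)
          (fun e => restrict_edge.2 ⟨e, hP _ _ (hl _ (by simp))⟩), ih h2 fun v hv => hl v (by simp [hv])⟩
  obtain ⟨h1, h2⟩ := List.isChain_cons_cons.1 h
  exact List.isChain_cons_cons.2 ⟨h1.imp (fun e => restrict_edge.2 ⟨e, hb e⟩)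
    (fun e => restrict_edge.2 ⟨e, hP _ _ (hl _ (by simp))⟩), aux _ h2 hl⟩

/-- If only edges out of `X` are deleted, a path of the remaining DAG whose non-colliders avoid
`Z` and whose colliders are ancestors of `X ∪ Y ∪ Z` yields a proper open path in that DAG. -/
lemma exists_proper_isOpen_restrict {X Y Z : Set V} (hP : ∀ a b, a ∉ X → P a b)
    (hXZ : Disjoint X Z) {p : List V} {x y : V} (hp : D.IsPathFrom p x y) (hx : x ∈ X)
    (hy : y ∈ Y) (hch : p.IsChain (D.restrict P).Adj)
    (ho : ∀ a w b, [a, w, b] <:+: p →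
      (D.Edge a w ∧ D.Edge b w → w ∈ D.Anc (X ∪ Y ∪ Z)) ∧
      (¬ (D.Edge a w ∧ D.Edge b w) → w ∉ Z)) :
    ∃ x' ∈ X, ∃ y' ∈ Y, ∃ p', D.IsPathFrom p' x' y' ∧ (∀ v ∈ p'.tail, v ∉ X) ∧
      p'.IsChain (D.restrict P).Adj ∧ D.IsOpen Z p' := by
  obtain ⟨x', hx', y', hy', p', ⟨h1, h2, h3, h4⟩, hpr, hop⟩ :=
    exists_proper_isOpen (D := D.restrict P) (Y := Y) hXZ ⟨hp.1, hch, hp.2.2⟩ hx hy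
      (fun a w b ht => by
        rw [restrict_collider_iff hch ht]
        have := ho a w b ht
        refine ⟨fun h => anc_subset_restrict hP ?_ (this.1 h), this.2⟩
        intro v hv
        exact Or.inl (Or.inl hv))
  refine ⟨x', hx', y', hy', p', ⟨h1, ?_, h3, h4⟩, hpr, h2, ?_⟩
  · exact List.IsChain.imp (fun _ _ h => adj_of_restrict h) h2
  · intro a w b ht
    have := hop a w b ht
    rw [OpenAt, restrict_collider_iff h2 ht] at this
    exact ⟨fun h => restrict_anc_subset _ (this.1 h), this.2⟩

end Restrict

/-! ### Paths between two node sets -/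

section Paths

variable {D : DAG V} {X Y : Set V}

lemma IsPathFrom.isChain {p : List V} {x y : V} (h : D.IsPathFrom p x y) : p.IsChain D.Adj :=
  h.2.1

lemma IsPathFrom.exists_cons_cons {p : List V} {x y : V} (h : D.IsPathFrom p x y)
    (hne : x ≠ y) : ∃ b l, p = x :: b :: l := by
  obtain ⟨-, -, h1, h2⟩ := h
  rcases p with _ | ⟨a, _ | ⟨b, l⟩⟩
  · simp at h1
  · simp at h1 h2
    exact absurd (h1.symm.trans h2) hne
  · exact ⟨b, l, by simpa using h1⟩

/-- A path can be cut at its first node in `Y`. -/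
lemma IsPathFrom.exists_isPrefix {p : List V} {x y : V} (h : D.IsPathFrom p x y) (hx : x ∉ Y)
    (hy : y ∈ Y) : ∃ p' y', p' <+: p ∧ y' ∈ Y ∧ D.IsPathFrom p' x y' ∧
      ∀ v ∈ p'.dropLast, v ∉ Y := by
  obtain ⟨h1, h2, h3, h4⟩ := h
  obtain ⟨l₁, y', l₂, rfl, hy', hl⟩ :=
    exists_first (p := p) (P := (· ∈ Y)) ⟨y, List.mem_of_getLast? h4, hy⟩
  have hpre : l₁ ++ [y'] <+: l₁ ++ y' :: l₂ := ⟨l₂, by simp⟩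
  refine ⟨l₁ ++ [y'], y', hpre, hy', ⟨h1.sublist hpre.sublist, List.IsChain.infix h2 hpre.isInfix,
    ?_, by simp⟩, by simpa using hl⟩
  rcases l₁ with _ | ⟨a, l₁⟩
  · simp only [List.nil_append, List.head?_cons, Option.some.injEq] at h3
    exact absurd (h3 ▸ hy') hx
  · simpa using h3

lemma forb_subset_desc : D.Forb X Y ⊆ D.Desc X := by
  rintro v ⟨p, w, ⟨⟨x, hx, y, -, -, -, h3, -⟩, -, hc⟩, hw, -, r⟩
  rcases p with _ | ⟨a, l⟩
  · simp at h3
  · obtain rfl : a = x := by simpa using h3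
    exact ⟨a, hx, (D.reach_of_causal hc hw).trans r⟩

/-- A descendant of `X` that starts a directed path to `Y` avoiding `X` is forbidden. -/
lemma mem_forb_of_causal {t y : V} {l : List V} (ht : t ∈ D.Desc X) (hy : y ∈ Y)
    (hc : (t :: l).IsChain D.Edge) (hlast : (t :: l).getLast? = some y)
    (hl : ∀ v ∈ t :: l, v ∉ X) : t ∈ D.Forb X Y := by
  obtain ⟨x, hx, r⟩ := ht
  have htX : t ∉ X := hl t (by simp)
  have key : t ∈ D.Forb X Y ∨ ∃ m, (x :: m).IsChain D.Edge ∧ (x :: m).getLast? = some y ∧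
      (∀ v ∈ x :: m, v ∉ X) ∧ t ∈ x :: m := by
    clear hx
    induction r using Relation.ReflTransGen.head_induction_on with
    | refl => exact Or.inr ⟨l, hc, hlast, hl, by simp⟩
    | @head a c e r ih =>
      rcases ih with h | ⟨m, h1, h2, h3, h4⟩
      · exact Or.inl h
      have h1' : (a :: c :: m).IsChain D.Edge := List.isChain_cons_cons.2 ⟨e, h1⟩
      have h2' : (a :: c :: m).getLast? = some y := by simpa [List.getLast?_cons] using h2
      by_cases ha : a ∈ X
      · refine Or.inl ⟨a :: c :: m, t, ⟨⟨a, ha, y, hy, D.nodup_of_causal h1', ?_, rfl, h2'⟩,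
          h3, h1'⟩, List.mem_cons_of_mem _ h4, htX, .refl⟩
        exact List.IsChain.imp (fun _ _ h => Or.inl h) h1'
      · refine Or.inr ⟨c :: m, h1', h2', ?_, List.mem_cons_of_mem _ h4⟩
        intro v hv
        rcases List.mem_cons.1 hv with rfl | hv
        · exact ha
        · exact h3 v hv
  rcases key with h | ⟨m, -, -, h3, -⟩
  · exact h
  · exact absurd hx (h3 x (by simp))

lemma second_mem_forb {x b y : V} {l : List V} (h : D.IsPathFrom (x :: b :: l) x y) (hx : x ∈ X)
    (hy : y ∈ Y) (hl : ∀ v ∈ b :: l, v ∉ X) (hc : (x :: b :: l).IsChain D.Edge) :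
    b ∈ D.Forb X Y :=
  ⟨x :: b :: l, b, ⟨⟨x, hx, y, hy, h⟩, hl, hc⟩, by simp, hl b (by simp), .refl⟩

lemma adjustSet_subset_anc : D.AdjustSet X Y ⊆ D.Anc (X ∪ Y) := fun _ h => h.1

lemma anc_adjustSet_subset : D.Anc (D.AdjustSet X Y) ⊆ D.Anc (X ∪ Y) :=
  fun _ ⟨_, h, r⟩ => mem_anc_of_reach r (adjustSet_subset_anc h)

lemma notMem_forb_of_mem_anc {v : V} (h : v ∈ D.Anc (D.AdjustSet X Y)) : v ∉ D.Forb X Y := by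
  obtain ⟨z, hz, r⟩ := h
  exact fun h => hz.2 (Or.inr (mem_forb_of_reach r h))

/-! ### The adjustment criterion -/

lemma not_satisfiesAC_of_condC2 (hXY : Disjoint X Y) (h : D.CondC2 X Y) {Z : Set V}
    (hZ : Disjoint Z (X ∪ Y)) : ¬ D.SatisfiesAC X Y Z := by
  rintro ⟨hforb, hblock⟩
  obtain ⟨p, ⟨⟨x, hx, y, hy, hp⟩, htail, hnc⟩, hcol, hncol⟩ := h
  obtain ⟨b, l, rfl⟩ := hp.exists_cons_cons (hXY.ne_of_mem hx hy)
  have hP : ∀ a b, a ∉ X → ¬ (a ∈ X ∧ b ∈ D.Forb X Y) := fun a b ha h => ha h.1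
  have hch := isChain_restrict (P := fun a b => ¬ (a ∈ X ∧ b ∈ D.Forb X Y)) hP hp.isChain
    htail (by
      rintro e ⟨-, hb⟩
      rcases D.causal_or_collider l hp.isChain e with h1 | ⟨u, c, v, ht, e1, e2, r⟩
      · exact hnc h1
      · exact (hcol c ⟨u, v, ht, e1, e2⟩).2 (Or.inr (mem_forb_of_reach r hb)))
  obtain ⟨x', hx', y', hy', p', hp', htail', hch', hop⟩ :=
    exists_proper_isOpen_restrict (Y := Y) (Z := Z) hP
      (Set.disjoint_of_subset_right Set.subset_union_left hZ).symm hp hx hy hch (by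
        intro a w c ht
        constructor
        · intro e
          exact D.anc_mono Set.subset_union_left (hcol w ⟨a, c, ht, e⟩).1
        · intro e hw
          have := hncol w ⟨⟨a, c, ht⟩, fun h => e ((D.isColliderOn_iff hp.1 ht).1 h)⟩
          exact Set.eq_empty_iff_forall_notMem.1 hforb w ⟨hw, this⟩)
  refine (D.not_blocks_iff hp'.1).2 hop (hblock p' ⟨⟨x', hx', y', hy', hp'⟩, htail', ?_⟩)
  intro hc
  obtain ⟨b', l', rfl⟩ := hp'.exists_cons_cons (hXY.ne_of_mem hx' hy')
  have e : D.Edge x' b' := (List.isChain_cons_cons.1 hc).1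
  have hb' := second_mem_forb hp' hx' hy' htail' hc
  exact (restrict_edge.1 ((restrict_edge_iff (List.isChain_cons_cons.1 hch').1).2 e)).2
    ⟨hx', hb'⟩

lemma condC2_of_isOpen (hXY : Disjoint X Y) {p : List V} (h : D.ProperNonCausalPath X Y p)
    (ho : D.IsOpen (D.AdjustSet X Y) p) : D.CondC2 X Y := by
  obtain ⟨⟨x, hx, y, hy, hp⟩, htail, hnc⟩ := h
  obtain ⟨p', y', hpre, hy', hp', hY⟩ :=
    hp.exists_isPrefix (Set.disjoint_left.1 hXY hx) hy
  have htail' : ∀ v ∈ p'.tail, v ∉ X := fun v hv => htail v (mem_tail_of_isPrefix hpre hv)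
  have ho' := ho.of_isInfix hpre.isInfix
  refine ⟨p', ⟨⟨x, hx, y', hy', hp'⟩, htail', ?_⟩, ?_, ?_⟩
  · intro hc
    obtain ⟨b, l, rfl⟩ := hp'.exists_cons_cons (hXY.ne_of_mem hx hy')
    obtain ⟨m, rfl⟩ := hpre
    have hb := second_mem_forb hp' hx hy' htail' hc
    rcases D.causal_or_collider (l ++ m) hp.isChain (List.isChain_cons_cons.1 hc).1 with
      h1 | ⟨u, c, v, ht, e1, e2, r⟩
    · exact hnc h1
    · exact notMem_forb_of_mem_anc ((ho _ _ _ ht).1 ⟨e1, e2⟩) (mem_forb_of_reach r hb)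
  · rintro w ⟨a, b, ht, e⟩
    have hw := (ho' _ _ _ ht).1 e
    obtain ⟨h1, h2⟩ := triple_mem ht
    refine ⟨anc_adjustSet_subset hw, ?_⟩
    rintro ((h | h) | h)
    · exact htail' w h1 h
    · exact hY w h2 h
    · exact notMem_forb_of_mem_anc hw h
  · rintro w ⟨⟨a, b, ht⟩, hc⟩
    have e := fun e => hc ((D.isColliderOn_iff hp'.1 ht).2 e)
    obtain ⟨h1, h2⟩ := triple_mem ht
    by_contra hF
    refine (ho' _ _ _ ht).2 e ⟨?_, ?_⟩
    · refine D.mem_anc_of_triple hp'.isChain hp'.2.2.1 hp'.2.2.2 ht e (Or.inl hx) (Or.inr hy') ?_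
      exact fun u c v ht e1 e2 => anc_adjustSet_subset ((ho' _ _ _ ht).1 ⟨e1, e2⟩)
    · rintro ((h | h) | h)
      · exact htail' w h1 h
      · exact hY w h2 h
      · exact hF h

lemma adjustSet_disjoint : Disjoint (D.AdjustSet X Y) (X ∪ Y) :=
  Set.disjoint_left.2 fun _ h h' => h.2 (Or.inl h')

lemma not_exists_satisfiesAC_iff (hXY : Disjoint X Y) :
    (¬ ∃ Z, Disjoint Z (X ∪ Y) ∧ D.SatisfiesAC X Y Z) ↔ D.CondC2 X Y := by
  constructor
  · intro h
    by_contra hc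
    refine h ⟨D.AdjustSet X Y, adjustSet_disjoint, ?_, ?_⟩
    · exact Set.eq_empty_iff_forall_notMem.2 fun v hv => hv.1.2 (Or.inr hv.2)
    · intro p hp
      by_contra hb
      obtain ⟨x, -, y, -, hpath⟩ := hp.1
      exact hc (condC2_of_isOpen hXY hp ((D.not_blocks_iff hpath.1).1 hb))
  · rintro h ⟨Z, hZ, hAC⟩
    exact not_satisfiesAC_of_condC2 hXY h hZ hAC

/-! ### Back-door criteria -/

lemma IsPathFrom.exists_backdoor {p : List V} {x y : V} (h : D.IsPathFrom p x y)
    (hb : D.IsBackdoorFrom p x) (hx : x ∉ Y) (hy : y ∈ Y) :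
    ∃ b l y', x :: b :: l <+: p ∧ D.Edge b x ∧ y' ∈ Y ∧ D.IsPathFrom (x :: b :: l) x y' ∧
      ∀ v ∈ (x :: b :: l).dropLast, v ∉ Y := by
  obtain ⟨c, m, rfl, e⟩ := hb
  obtain ⟨p', y', hpre, hy', hp', hY⟩ := h.exists_isPrefix hx hy
  obtain ⟨b, l, rfl⟩ := hp'.exists_cons_cons (fun h => hx (h ▸ hy') : x ≠ y')
  obtain ⟨t, ht⟩ := hpre
  obtain rfl : b = c := by simp at ht; exact ht.1
  exact ⟨b, l, y', ⟨t, ht⟩, e, hy', hp', hY⟩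

lemma not_isCausal_of_backdoor {x b : V} {l : List V} (e : D.Edge b x) :
    ¬ D.IsCausal (x :: b :: l) :=
  fun h => D.edge_asymm e (List.isChain_cons_cons.1 h).1

/-- A set of non-descendants of `X` that blocks all proper back-door paths satisfies the
adjustment criterion once its nodes in `Y` are removed. -/
lemma satisfiesAC_of_blocks_backdoor (hXY : Disjoint X Y) {Z : Set V}
    (hZ : Z ∩ D.Desc X = ∅)
    (h : ∀ x ∈ X, ∀ y ∈ Y, ∀ p, D.IsPathFrom p x y → D.IsBackdoorFrom p x →
      (∀ v ∈ p.tail, v ∉ X) → D.Blocks Z p) :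
    ∃ Z', Disjoint Z' (X ∪ Y) ∧ D.SatisfiesAC X Y Z' := by
  have hZ' : ∀ v ∈ Z, v ∉ D.Desc X := fun v hv hv' =>
    Set.eq_empty_iff_forall_notMem.1 hZ v ⟨hv, hv'⟩
  refine ⟨Z \ Y, ?_, ?_, ?_⟩
  · refine Set.disjoint_left.2 ?_
    rintro v ⟨hv, hvY⟩ (hvX | hvY')
    · exact hZ' v hv (D.subset_desc X hvX)
    · exact hvY hvY'
  · exact Set.eq_empty_iff_forall_notMem.2 fun v hv => hZ' v hv.1.1 (forb_subset_desc hv.2)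
  · rintro p ⟨⟨x, hx, y, hy, hp⟩, htail, hnc⟩
    by_contra hb
    have ho := (D.not_blocks_iff hp.1).1 hb
    obtain ⟨b, l, rfl⟩ := hp.exists_cons_cons (hXY.ne_of_mem hx hy)
    rcases (List.isChain_cons_cons.1 hp.isChain).1 with e | e
    · rcases D.causal_or_collider l hp.isChain e with h1 | ⟨u, c, v, ht, e1, e2, r⟩
      · exact hnc h1
      · obtain ⟨z, hz, r'⟩ := (ho _ _ _ ht).1 ⟨e1, e2⟩
        exact hZ' z hz.1 ⟨x, hx, .head e (r.trans r')⟩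
    · obtain ⟨b', l', y', hpre, e', hy', hp', hY⟩ :=
        hp.exists_backdoor ⟨b, l, rfl, e⟩ (Set.disjoint_left.1 hXY hx) hy
      have hop := ho.of_isInfix hpre.isInfix
      refine (D.not_blocks_iff hp'.1).2 ?_ (h x hx y' hy' _ hp' ⟨b', l', rfl, e'⟩
        fun v hv => htail v (mem_tail_of_isPrefix hpre hv))
      intro a w c ht
      refine ⟨fun h => D.anc_mono Set.sdiff_subset ((hop _ _ _ ht).1 h), fun h hw => ?_⟩
      exact (hop _ _ _ ht).2 h ⟨hw, hY w (triple_mem ht).2⟩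

lemma exists_satisfiesAC_of_backdoor (hXY : Disjoint X Y) {Z : Set V}
    (h : D.BackdoorCriterion X Y Z) :
    ∃ Z', Disjoint Z' (X ∪ Y) ∧ D.SatisfiesAC X Y Z' :=
  satisfiesAC_of_blocks_backdoor hXY h.1 fun x hx y hy p hp hb _ => h.2 x hx y hy p hp hb

lemma exists_satisfiesAC_of_genBackdoor (hXY : Disjoint X Y) {Z : Set V}
    (h : D.GenBackdoorCriterion X Y Z) :
    ∃ Z', Disjoint Z' (X ∪ Y) ∧ D.SatisfiesAC X Y Z' := by
  have hZ' : ∀ v ∈ Z, v ∉ D.Desc X := fun v hv hv' =>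
    Set.eq_empty_iff_forall_notMem.1 h.1 v ⟨hv, hv'⟩
  refine satisfiesAC_of_blocks_backdoor hXY h.1 fun x hx y hy p hp hb htail => ?_
  by_contra hbl
  have ho := (D.not_blocks_iff hp.1).1 hbl
  refine (D.not_blocks_iff hp.1).2 ?_ (h.2 x hx y hy p hp hb)
  intro a w b ht
  constructor
  · intro e
    obtain ⟨z, hz, r⟩ := (ho _ _ _ ht).1 e
    refine ⟨z, ⟨Or.inl hz, ?_⟩, r⟩
    rintro rfl
    exact hZ' _ hz (D.subset_desc X hx)
  · rintro e ⟨hw | hw, -⟩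
    · exact (ho _ _ _ ht).2 e hw
    · exact htail w (triple_mem ht).1 hw

/-- On a back-door path that is open given `Adjust(X, Y) \ De(X)`, all interior nodes are
descendants of `X` and there is no collider. -/
lemma backdoor_structure {x b y : V} {l : List V} (hp : D.IsPathFrom (x :: b :: l) x y)
    (hx : x ∈ X) (hy : y ∈ Y) (e : D.Edge b x) (hY : ∀ v ∈ (x :: b :: l).dropLast, v ∉ Y)
    (ho : D.IsOpen (D.AdjustSet X Y \ D.Desc X) (x :: b :: l)) :
    (∀ a w c, [a, w, c] <:+: x :: b :: l → w ∈ D.Desc X) ∧ D.NoCollider (x :: b :: l) := by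
  have hcol : ∀ w ∈ D.Anc (D.AdjustSet X Y \ D.Desc X),
      w ∈ D.Anc (X ∪ Y) ∧ w ∉ D.Desc X := by
    intro w hw
    refine ⟨anc_adjustSet_subset (D.anc_mono Set.sdiff_subset hw), fun h => ?_⟩
    obtain ⟨z, hz, r⟩ := hw
    exact hz.2 (mem_desc_of_reach r h)
  have hnon : ∀ a w c, [a, w, c] <:+: x :: b :: l → ¬ (D.Edge a w ∧ D.Edge c w) →
      w ∈ D.Desc X := by
    intro a w c ht hw
    by_contra hD
    have hA : w ∈ D.Anc (X ∪ Y) := by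
      refine D.mem_anc_of_triple hp.isChain hp.2.2.1 hp.2.2.2 ht hw (Or.inl hx) (Or.inr hy) ?_
      exact fun u c v ht e1 e2 => (hcol _ ((ho _ _ _ ht).1 ⟨e1, e2⟩)).1
    refine (ho _ _ _ ht).2 hw ⟨⟨hA, ?_⟩, hD⟩
    rintro ((h | h) | h)
    · exact hD (D.subset_desc X h)
    · exact hY w (triple_mem ht).2 h
    · exact hD (forb_subset_desc h)
  have hno : D.NoCollider (x :: b :: l) := by
    intro a w c ht hw
    refine (hcol _ ((ho _ _ _ ht).1 hw)).2 ?_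
    obtain ⟨s, t, h⟩ := id ht
    rcases List.eq_nil_or_concat s with rfl | ⟨s, d, rfl⟩
    · simp only [List.nil_append, List.cons_append, List.cons.injEq] at h
      obtain ⟨rfl, rfl, -⟩ := h
      exact absurd hw.1 (D.edge_asymm e)
    · have ht' : [d, a, w] <:+: x :: b :: l := ⟨s, c :: t, by simpa using h⟩
      exact mem_desc_of_reach (.single hw.1) (hnon _ _ _ ht' fun h => D.edge_asymm hw.1 h.2)
  exact ⟨fun a w c ht => hnon a w c ht (hno a w c ht), hno⟩

/-- A proper back-door path that is open given `Adjust(X, Y) \ De(X)` witnesses the first or the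
second condition. -/
lemma condC2_or_condC3 {x b y : V} {l : List V} (hp : D.IsPathFrom (x :: b :: l) x y)
    (hx : x ∈ X) (hy : y ∈ Y) (e : D.Edge b x) (hY : ∀ v ∈ (x :: b :: l).dropLast, v ∉ Y)
    (ho : D.IsOpen (D.AdjustSet X Y \ D.Desc X) (x :: b :: l))
    (hX : ∀ v ∈ b :: l, v ∉ X) : D.CondC2 X Y ∨ D.CondC3 X Y := by
  obtain ⟨hD, hno⟩ := backdoor_structure hp hx hy e hY ho
  have hpnc : D.ProperNonCausalPath X Y (x :: b :: l) :=
    ⟨⟨x, hx, y, hy, hp⟩, hX, not_isCausal_of_backdoor e⟩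
  have hC2 : (∀ a w c, [a, w, c] <:+: x :: b :: l → w ∈ D.Forb X Y) → D.CondC2 X Y := by
    intro h
    refine ⟨_, hpnc, ?_, ?_⟩
    · rintro w ⟨a, c, ht, e⟩
      exact absurd e (hno a w c ht)
    · rintro w ⟨⟨a, c, ht⟩, -⟩
      exact h a w c ht
  rcases D.reverse_causal_or_source l hp.isChain hno e with h | ⟨l₁, t, l₂, heq, hne, h1, h2⟩
  · rcases List.eq_nil_or_concat l with rfl | ⟨l', y', rfl⟩
    · refine Or.inl (hC2 fun a w c ht => ?_)
      simpa using ht.length_le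
    obtain rfl : y' = y := by
      have := hp.2.2.2
      simpa [List.getLast?_cons] using this
    obtain ⟨m, v, hm⟩ : ∃ m v, b :: l' = m ++ [v] := by
      rcases List.eq_nil_or_concat (b :: l') with h | ⟨m, v, h⟩
      · simp at h
      · exact ⟨m, v, by simpa using h⟩
    have heq : x :: b :: l'.concat y' = (x :: m) ++ [v, y'] := by
      have : b :: (l' ++ [y']) = (b :: l') ++ [y'] := rfl
      simp [this, hm]
    have hrev : (y' :: v :: (x :: m).reverse).IsChain D.Edge := by
      have := List.isChain_reverse.2 h
      rw [heq] at this
      simpa using this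
    have hv : ∀ w ∈ (x :: m) ++ [v], Relation.ReflTransGen D.Edge v w := by
      intro w hw
      refine D.reach_of_causal (List.isChain_cons_cons.1 hrev).2 ?_
      simp only [List.mem_append, List.mem_cons, List.mem_reverse] at hw ⊢
      tauto
    have hdrop : (x :: b :: l'.concat y').dropLast = (x :: m) ++ [v] := by
      rw [heq, show (x :: m) ++ [v, y'] = ((x :: m) ++ [v]) ++ [y'] by simp,
        List.dropLast_concat]
    by_cases hvF : v ∈ D.Forb X Y
    · refine Or.inl (hC2 fun a w c ht => mem_forb_of_reach (hv w ?_) hvF)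
      have := (triple_mem ht).2
      rwa [hdrop] at this
    · right
      obtain ⟨n, a, hn⟩ : ∃ n a, x :: m = n ++ [a] := by
        rcases List.eq_nil_or_concat (x :: m) with h | ⟨n, a, h⟩
        · simp at h
        · exact ⟨n, a, by simpa using h⟩
      have ht : [a, v, y'] <:+: x :: b :: l'.concat y' := ⟨n, [], by rw [heq, hn]; simp⟩
      have hsuf : [v, y'] <:+ x :: b :: l'.concat y' := ⟨x :: m, heq.symm⟩
      refine ⟨x, hx, y', hy, _, v, hp, hpnc, ⟨⟨?_, ?_⟩, hD _ _ _ ht⟩, ⟨⟨_, _, ht⟩, ?_⟩, ?_,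
        ?_, ?_, hsuf⟩
      · exact ⟨x, Or.inl hx, hv x (by simp)⟩
      · rintro ((h | h) | h)
        · exact hX v (triple_mem ht).1 h
        · exact hY v (triple_mem ht).2 h
        · exact hvF h
      · rintro ⟨c, d, ht', e'⟩
        exact hno _ _ _ ht' e'
      · rintro w ⟨c, d, ht', e'⟩
        exact absurd e' (hno _ _ _ ht')
      · rintro s hs hhead w ⟨⟨c, d, ht'⟩, -⟩
        exfalso
        have hshort : s <:+ [v, y'] := by
          rcases List.suffix_or_suffix_of_suffix hs hsuf with h' | ⟨r, rfl⟩
          · exact h'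
          · rcases r with _ | ⟨f, r⟩
            · exact List.suffix_rfl
            · obtain rfl : f = v := by simpa using hhead
              have := hp.1.sublist hs.sublist
              simp at this
        have h1 := ht'.length_le
        have h2 := hshort.length_le
        simp at h1 h2
        omega
      · exact List.isChain_reverse.2 h
  · left
    have hsuf : t :: l₂ <:+ b :: l := by
      refine ⟨l₁, ?_⟩
      simpa using heq.symm
    obtain ⟨n, a, hn⟩ : ∃ n a, x :: l₁ = n ++ [a] := by
      rcases List.eq_nil_or_concat (x :: l₁) with h | ⟨n, a, h⟩
      · simp at h
      · exact ⟨n, a, by simpa using h⟩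
    obtain ⟨c, l₃, rfl⟩ := List.exists_cons_of_ne_nil hne
    have ht : [a, t, c] <:+: x :: b :: l := ⟨n, l₃, by rw [heq, hn]; simp⟩
    have htF : t ∈ D.Forb X Y := by
      refine mem_forb_of_causal (hD _ _ _ ht) hy h2 ?_ fun v hv => hX v (hsuf.subset hv)
      have := hp.2.2.2
      rw [heq] at this
      simpa [List.getLast?_append, List.getLast?_cons] using this
    refine hC2 fun a' w c' ht' => mem_forb_of_reach ?_ htF
    have hw : w ∈ x :: l₁ ++ t :: c :: l₃ := by
      rw [← heq]
      exact List.mem_of_mem_tail (triple_mem ht').1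
    rcases List.mem_append.1 hw with hw | hw
    · have h3 : (t :: (x :: l₁).reverse).IsChain D.Edge := by
        have := List.isChain_reverse.2 h1
        simpa using this
      exact D.reach_of_causal h3 (by
        simp only [List.mem_cons, List.mem_reverse] at hw ⊢
        tauto)
    · exact D.reach_of_causal h2 hw

lemma isOpen_of_condC3_path {p : List V} {x y : V} (hp : D.IsPathFrom p x y)
    (hc : D.IsCausal p.reverse) {v : V} (hv : v ∈ D.Desc X) (hsuf : [v, y] <:+ p) {Z : Set V}
    (hZ : ∀ w ∈ p.tail, w ∈ D.Desc X → w ∉ Z) : D.IsOpen Z p := by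
  obtain ⟨s, rfl⟩ := hsuf
  have hrev : (y :: v :: s.reverse).IsChain D.Edge := by
    have h : List.IsChain D.Edge (s ++ [v, y]).reverse := hc
    simpa using h
  intro a w b ht
  have hedge : D.Edge b w ∧ D.Edge w a := by
    have h : List.IsChain D.Edge (s ++ [v, y]).reverse := hc
    simpa using h.infix (triple_reverse ht)
  refine ⟨fun h => absurd h.1 (D.edge_asymm hedge.2), fun _ => hZ w (triple_mem ht).1 ?_⟩
  have hw := (triple_mem ht).2
  rw [show s ++ [v, y] = (s ++ [v]) ++ [y] by simp, List.dropLast_concat] at hw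
  refine mem_desc_of_reach (D.reach_of_causal (List.isChain_cons_cons.1 hrev).2 ?_) hv
  simp only [List.mem_append, List.mem_cons, List.mem_reverse] at hw ⊢
  tauto

lemma isBackdoorFrom_of_reverse_causal {p : List V} {x y : V} (hp : D.IsPathFrom p x y)
    (hne : x ≠ y) (hc : D.IsCausal p.reverse) : D.IsBackdoorFrom p x := by
  obtain ⟨b, l, rfl⟩ := hp.exists_cons_cons hne
  exact ⟨b, l, rfl, (List.isChain_cons_cons.1 (List.isChain_reverse.1 hc)).1⟩

lemma not_genBackdoor_of_condC3 (hXY : Disjoint X Y) (h : D.CondC3 X Y) (Z : Set V) :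
    ¬ D.GenBackdoorCriterion X Y Z := by
  rintro ⟨hZ, hb⟩
  obtain ⟨x, hx, y, hy, p, v, hp, hpnc, hv, -, -, -, hc, hsuf⟩ := h
  refine (D.not_blocks_iff hp.1).2 ?_ (hb x hx y hy p hp
    (isBackdoorFrom_of_reverse_causal hp (hXY.ne_of_mem hx hy) hc))
  refine isOpen_of_condC3_path hp hc hv.2 hsuf ?_
  rintro w hw hD ⟨h | h, -⟩
  · exact Set.eq_empty_iff_forall_notMem.1 hZ w ⟨h, hD⟩
  · exact hpnc.2.1 w hw h

lemma not_backdoor_of_condC3 (hXY : Disjoint X Y) (h : D.CondC3 X Y) (Z : Set V) :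
    ¬ D.BackdoorCriterion X Y Z := by
  rintro ⟨hZ, hb⟩
  obtain ⟨x, hx, y, hy, p, v, hp, hpnc, hv, -, -, -, hc, hsuf⟩ := h
  refine (D.not_blocks_iff hp.1).2 ?_ (hb x hx y hy p hp
    (isBackdoorFrom_of_reverse_causal hp (hXY.ne_of_mem hx hy) hc))
  refine isOpen_of_condC3_path hp hc hv.2 hsuf ?_
  exact fun w hw hD h => Set.eq_empty_iff_forall_notMem.1 hZ w ⟨h, hD⟩

lemma not_backdoor_of_condC4 (h : D.CondC4 X Y) (Z : Set V) :
    ¬ D.BackdoorCriterion X Y Z := by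
  rintro ⟨hZ, hb⟩
  obtain ⟨x, hx, y, hy, p, hp, hbd, -, hno, hD⟩ := h
  refine (D.not_blocks_iff hp.1).2 ?_ (hb x hx y hy p hp hbd)
  intro a w b ht
  refine ⟨fun h => absurd ⟨a, b, ht, h⟩ (hno w), fun _ hw => ?_⟩
  exact Set.eq_empty_iff_forall_notMem.1 hZ w ⟨hw, hD w (List.mem_of_mem_tail (triple_mem ht).1)⟩

lemma adjustSet_diff_desc : (D.AdjustSet X Y \ D.Desc X) ∩ D.Desc X = ∅ := by
  simp

lemma exists_genBackdoor (hXY : Disjoint X Y) (h2 : ¬ D.CondC2 X Y) (h3 : ¬ D.CondC3 X Y) :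
    D.GenBackdoorCriterion X Y (D.AdjustSet X Y \ D.Desc X) := by
  refine ⟨adjustSet_diff_desc, ?_⟩
  set Z := D.AdjustSet X Y \ D.Desc X with hZdef
  have hXZ : Disjoint X Z :=
    Set.disjoint_left.2 fun v hv hv' => hv'.2 (D.subset_desc X hv)
  intro x hx y hy p hp hbd
  by_contra hbl
  have ho := (D.not_blocks_iff hp.1).1 hbl
  obtain ⟨l₁, x', l₂, heq, hx', hl₂⟩ := exists_last (p := p) (P := (· ∈ X))
    ⟨x, List.mem_of_mem_head? hp.2.2.1, hx⟩
  have hsuf : x' :: l₂ <:+ p := ⟨l₁, heq.symm⟩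
  have hp' : D.IsPathFrom (x' :: l₂) x' y := by
    refine ⟨hp.1.sublist hsuf.sublist, hp.isChain.suffix hsuf, rfl, ?_⟩
    have := hp.2.2.2
    rw [heq] at this
    simpa [List.getLast?_append, List.getLast?_cons] using this
  obtain ⟨b, l, hbl⟩ := hp'.exists_cons_cons (hXY.ne_of_mem hx' hy)
  obtain rfl : l₂ = b :: l := (List.cons.inj hbl).2
  have e : D.Edge b x' := by
    rcases List.eq_nil_or_concat l₁ with rfl | ⟨l₁, a, rfl⟩
    · obtain ⟨c, m, hcm, e⟩ := hbd
      rw [hcm] at heq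
      simp only [List.nil_append, List.cons.injEq] at heq
      obtain ⟨rfl, rfl, -⟩ := heq
      exact e
    · have ht : [a, x', b] <:+: p := ⟨l₁, l, by rw [heq]; simp⟩
      have hne : x' ≠ x := by
        rintro rfl
        have h1 := hp.2.2.1
        have h2 := hp.1
        rw [heq] at h1 h2
        rcases l₁ with _ | ⟨c, l₁⟩ <;> simp_all
      by_contra e
      exact (ho _ _ _ ht).2 (fun h => e h.2) ⟨Or.inr hx', hne⟩
  have hP : ∀ a b : V, a ∉ X → (fun a _ => a ∉ X) a b := fun a b h => h
  have hch := isChain_restrict (P := fun a _ => a ∉ X) hP hp'.isChain hl₂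
    (fun e' => absurd e' (D.edge_asymm e))
  obtain ⟨x'', hx'', y'', hy'', q, hq, htail, hqch, hqo⟩ :=
    exists_proper_isOpen_restrict (Y := Y) (Z := Z) hP hXZ hp' hx' hy hch (by
      intro a w c ht
      have hw := ho a w c (ht.trans hsuf.isInfix)
      constructor
      · intro e
        obtain ⟨z, ⟨hz | hz, -⟩, r⟩ := hw.1 e
        · exact ⟨z, Or.inr hz, r⟩
        · exact ⟨z, Or.inl (Or.inl hz), r⟩
      · intro e' hwZ
        refine hw.2 e' ⟨Or.inl hwZ, ?_⟩
        rintro rfl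
        exact hwZ.2 (D.subset_desc X hx))
  have hqb : D.IsBackdoorFrom q x'' := by
    obtain ⟨c, m, rfl⟩ := hq.exists_cons_cons (hXY.ne_of_mem hx'' hy'')
    refine ⟨c, m, rfl, ?_⟩
    rcases (List.isChain_cons_cons.1 hqch).1 with e | e
    · exact absurd hx'' (restrict_edge.1 e).2
    · exact (restrict_edge.1 e).1
  obtain ⟨c, m, z, hpre, e', hz, hr, hY⟩ :=
    hq.exists_backdoor hqb (Set.disjoint_left.1 hXY hx'') hy''
  rcases condC2_or_condC3 hr hx'' hz e' hY (hqo.of_isInfix hpre.isInfix)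
    (fun v hv => htail v (mem_tail_of_isPrefix hpre hv)) with h | h
  · exact h2 h
  · exact h3 h

lemma exists_backdoor (hXY : Disjoint X Y) (h2 : ¬ D.CondC2 X Y) (h3 : ¬ D.CondC3 X Y)
    (h4 : ¬ D.CondC4 X Y) : D.BackdoorCriterion X Y (D.AdjustSet X Y \ D.Desc X) := by
  refine ⟨adjustSet_diff_desc, ?_⟩
  intro x hx y₀ hy₀ p₀ hp₀ hbd₀
  by_contra hbl
  obtain ⟨b, l, y, hpre, e, hy, hp, hY⟩ :=
    hp₀.exists_backdoor hbd₀ (Set.disjoint_left.1 hXY hx) hy₀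
  have ho := ((D.not_blocks_iff hp₀.1).1 hbl).of_isInfix hpre.isInfix
  have hC : ¬ (D.CondC2 X Y ∨ D.CondC3 X Y) := not_or.2 ⟨h2, h3⟩
  obtain ⟨hD, hno⟩ := backdoor_structure hp hx hy e hY ho
  by_cases hX : ∀ v ∈ b :: l, v ∉ X
  · exact hC (condC2_or_condC3 hp hx hy e hY ho hX)
  push Not at hX
  obtain ⟨l₁, x', l₂, heq, hx', hl₂⟩ := exists_last (p := b :: l) (P := (· ∈ X)) hX
  have hsuf : x' :: l₂ <:+ x :: b :: l := ⟨x :: l₁, by simp [heq]⟩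
  have hp' : D.IsPathFrom (x' :: l₂) x' y := by
    refine ⟨hp.1.sublist hsuf.sublist, hp.isChain.suffix hsuf, rfl, ?_⟩
    have := hp.2.2.2
    rw [heq] at this
    simpa [List.getLast?_append, List.getLast?_cons] using this
  have hne : x' ≠ x := by
    rintro rfl
    refine (List.nodup_cons.1 hp.1).1 ?_
    rw [heq]
    simp
  obtain ⟨c, m, hcm⟩ := hp'.exists_cons_cons (hXY.ne_of_mem hx' hy)
  obtain rfl : l₂ = c :: m := (List.cons.inj hcm).2
  rcases (List.isChain_cons_cons.1 hp'.isChain).1 with e' | e'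
  · have hcausal : (x' :: c :: m).IsChain D.Edge := by
      rcases D.causal_or_collider m hp'.isChain e' with h1 | ⟨u, d, v, ht, e1, e2, -⟩
      · exact h1
      · exact absurd ⟨e1, e2⟩ (hno _ _ _ (ht.trans hsuf.isInfix))
    refine h4 ⟨x, hx, y, hy, _, hp, ⟨b, l, rfl, e⟩, ⟨x', hx', hne, _, hsuf, rfl,
      ⟨x', hx', y, hy, hp'⟩, hl₂, hcausal⟩, ?_, ?_⟩
    · rintro w ⟨a, d, ht, h⟩
      exact hno _ _ _ ht h
    · intro w hw
      obtain ⟨s, t, hst⟩ := List.mem_iff_append.1 hw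
      rcases List.eq_nil_or_concat s with rfl | ⟨s, a, rfl⟩
      · obtain rfl : x = w := (List.cons.inj hst).1
        exact D.subset_desc X hx
      · rcases t with _ | ⟨d, t⟩
        · obtain rfl : w = y := by
            have := hp.2.2.2
            rw [hst] at this
            simpa using this
          exact ⟨x', hx', D.reach_of_causal hcausal (List.mem_of_getLast? hp'.2.2.2)⟩
        · exact hD a w d ⟨s, t, by rw [hst]; simp⟩
  · refine hC (condC2_or_condC3 hp' hx' hy e' ?_ (ho.of_isInfix hsuf.isInfix) hl₂)
    intro v hv
    refine hY v ?_
    obtain ⟨s, hs⟩ := hsuf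
    rw [← hs, List.dropLast_append_of_ne_nil (by simp)]
    exact List.mem_append_right _ hv

end Paths

/-- (i) No set disjoint from `X ∪ Y` satisfies the adjustment
criterion relative to `(X, Y)` in `D` iff (C2) holds; (ii) there is no generalized
back-door set relative to `(X, Y)` in `D` iff (C2) or (C3) holds; (iii) there is no
back-door set relative to `(X, Y)` in `D` iff (C2), (C3) or (C4) holds. -/
theorem criteria_differ_characterization
    (D : DAG V) (X Y : Set V)
    (hXY : Disjoint X Y) (hX : X.Nonempty) (hY : Y.Nonempty) :
    ((¬ ∃ Z, Disjoint Z (X ∪ Y) ∧ D.SatisfiesAC X Y Z) ↔ D.CondC2 X Y) ∧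
    ((¬ ∃ Z, D.GenBackdoorCriterion X Y Z) ↔ (D.CondC2 X Y ∨ D.CondC3 X Y)) ∧
    ((¬ ∃ Z, D.BackdoorCriterion X Y Z) ↔
        (D.CondC2 X Y ∨ D.CondC3 X Y ∨ D.CondC4 X Y)) := by
  have hAC := not_exists_satisfiesAC_iff (D := D) hXY
  refine ⟨hAC, ⟨fun h => ?_, ?_⟩, ⟨fun h => ?_, ?_⟩⟩
  · by_contra hc
    obtain ⟨h2, h3⟩ := not_or.1 hc
    exact h ⟨_, exists_genBackdoor hXY h2 h3⟩
  · rintro (h2 | h3) ⟨Z, hZ⟩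
    · exact hAC.2 h2 (exists_satisfiesAC_of_genBackdoor hXY hZ)
    · exact not_genBackdoor_of_condC3 hXY h3 Z hZ
  · by_contra hc
    obtain ⟨h2, hc⟩ := not_or.1 hc
    obtain ⟨h3, h4⟩ := not_or.1 hc
    exact h ⟨_, exists_backdoor hXY h2 h3 h4⟩
  · rintro (h2 | h3 | h4) ⟨Z, hZ⟩
    · exact hAC.2 h2 (exists_satisfiesAC_of_backdoor hXY hZ)
    · exact not_backdoor_of_condC3 hXY h3 Z hZ
    · exact not_backdoor_of_condC4 h4 Z hZ

end DAG
end
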